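/- arXiv:2411.13969 — 3 statements merged into one kernel-verified Lean document; each statement's English description precedes it below -/
import Mathlib

section
/- Let ρ₁ and ρ₂ be probability measures on X×Y whose second marginal (pushforward under the projection to Y) equals ν, and assume at least one of ρ₁, ρ₂ is absolutely continuous with respect to 𝓛⊗ν. Then ∫_Y W(ρ_{1,y}, ρ_{2,y})² dν(y) equals the infimum, over all nonnegative measures γ on X×X×Y whose pushforward under (x,x',y)↦(x,y) equals ρ₁ and whose pushforward under (x,x',y)↦(x',y) equals ρ₂, of ∫_{X×X×Y} |x−x'|² dγ(x,x',y). -/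
open MeasureTheory ProbabilityTheory Filter Set
open scoped ENNReal Topology

noncomputable section

abbrev Euc (n : ℕ) : Type := EuclideanSpace ℝ (Fin n)

/-- The set of couplings (transport plans) between two measures. -/
def Couplings {α β : Type*} [MeasurableSpace α] [MeasurableSpace β]
    (μ : Measure α) (ν : Measure β) : Set (Measure (α × β)) :=
  {γ | IsProbabilityMeasure γ ∧ γ.map Prod.fst = μ ∧ γ.map Prod.snd = ν}

/-- Optimal transport cost between two measures for cost `c`. -/
def transportCost {α β : Type*} [MeasurableSpace α] [MeasurableSpace β]
    (c : α → β → ℝ≥0∞) (μ : Measure α) (ν : Measure β) : ℝ≥0∞ :=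
  ⨅ γ ∈ Couplings μ ν, ∫⁻ p, c p.1 p.2 ∂γ

/-- Squared 2-Wasserstein distance. -/
noncomputable def W2sq {α : Type*} [MeasurableSpace α] [PseudoEMetricSpace α]
    (μ ν : Measure α) : ℝ≥0∞ :=
  transportCost (fun a b => edist a b ^ 2) μ ν

/-- `K` is the disintegration of `ρ` (a measure on `α × β`) with respect to its
second marginal `ν`: a Markov kernel such that `ρ(s × t) = ∫_t K_y(s) dν(y)`. -/
def IsDisint {α β : Type*} [MeasurableSpace α] [MeasurableSpace β]
    (ν : Measure β) (ρ : Measure (α × β)) (K : Kernel β α) : Prop :=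
  IsMarkovKernel K ∧
    ∀ s : Set α, ∀ t : Set β, MeasurableSet s → MeasurableSet t →
      ρ (s ×ˢ t) = ∫⁻ y in t, K y s ∂ν


section Matrices

variable {ι : Type*} [Fintype ι]

/-- A matrix `q` is a subcoupling of the vectors `a`, `b` if its row and column sums are bounded
by `a` and `b`. -/
def IsSubcoupling (q : ι → ι → ℝ≥0∞) (a b : ι → ℝ≥0∞) : Prop :=
  (∀ i, ∑ j, q i j ≤ a i) ∧ ∀ j, ∑ i, q i j ≤ b j

/-- The completion of a subcoupling by the product of the residual vectors. -/
def completion (q : ι → ι → ℝ≥0∞) (a b : ι → ℝ≥0∞) (i j : ι) : ℝ≥0∞ :=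
  q i j + (a i - ∑ k, q i k) * (b j - ∑ k, q k j) / ∑ l, (a l - ∑ k, q l k)

lemma sum_sub_of_le {u v : ι → ℝ≥0∞} (h : ∀ i, u i ≤ v i) (hv : ∑ i, v i ≠ ∞) :
    ∑ i, (v i - u i) = ∑ i, v i - ∑ i, u i := by
  have hu : ∑ i, u i ≠ ∞ := ne_top_of_le_ne_top hv (Finset.sum_le_sum fun i _ => h i)
  refine ENNReal.eq_sub_of_add_eq hu ?_
  rw [← Finset.sum_add_distrib]
  exact Finset.sum_congr rfl fun i _ => tsub_add_cancel_of_le (h i)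

lemma IsSubcoupling.sum_residual_eq {q : ι → ι → ℝ≥0∞} {a b : ι → ℝ≥0∞}
    (h : IsSubcoupling q a b) (hab : ∑ i, a i = ∑ i, b i) (ha : ∑ i, a i ≠ ∞) :
    ∑ i, (a i - ∑ k, q i k) = ∑ j, (b j - ∑ k, q k j) := by
  rw [sum_sub_of_le h.1 ha, sum_sub_of_le h.2 (hab ▸ ha), hab, Finset.sum_comm]

lemma IsSubcoupling.sum_completion_right {q : ι → ι → ℝ≥0∞} {a b : ι → ℝ≥0∞}
    (h : IsSubcoupling q a b) (hab : ∑ i, a i = ∑ i, b i) (ha : ∑ i, a i ≠ ∞) (i : ι) :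
    ∑ j, completion q a b i j = a i := by
  have hle : a i - ∑ k, q i k ≤ ∑ l, (a l - ∑ k, q l k) :=
    Finset.single_le_sum (f := fun l => a l - ∑ k, q l k) (fun _ _ => zero_le) (Finset.mem_univ i)
  have hr : ∑ l, (a l - ∑ k, q l k) ≠ ∞ :=
    ne_top_of_le_ne_top ha (Finset.sum_le_sum fun l _ => tsub_le_self)
  simp only [completion, div_eq_mul_inv, Finset.sum_add_distrib]
  rw [← Finset.sum_mul, ← Finset.mul_sum, ← h.sum_residual_eq hab ha, ← div_eq_mul_inv,
    ENNReal.mul_div_cancel_right', add_tsub_cancel_of_le (h.1 i)]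
  · intro h0
    exact le_antisymm (h0 ▸ hle) zero_le
  · exact fun h0 => absurd h0 hr

lemma IsSubcoupling.sum_completion_left {q : ι → ι → ℝ≥0∞} {a b : ι → ℝ≥0∞}
    (h : IsSubcoupling q a b) (hab : ∑ i, a i = ∑ i, b i) (ha : ∑ i, a i ≠ ∞) (j : ι) :
    ∑ i, completion q a b i j = b j := by
  have h' : IsSubcoupling (fun i j => q j i) b a := ⟨h.2, h.1⟩
  rw [← h'.sum_completion_right hab.symm (hab ▸ ha) j]
  refine Finset.sum_congr rfl fun i _ => ?_
  rw [completion, completion, h.sum_residual_eq hab ha, mul_comm]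

lemma sum_completion_mul_le {q : ι → ι → ℝ≥0∞} {a b : ι → ℝ≥0∞}
    (h : IsSubcoupling q a b) (hab : ∑ i, a i = ∑ i, b i) (ha : ∑ i, a i ≠ ∞)
    {c : ι → ι → ℝ≥0∞} {M : ℝ≥0∞} (hc : ∀ i j, c i j ≤ M) :
    ∑ i, ∑ j, completion q a b i j * c i j
      ≤ ∑ i, ∑ j, q i j * c i j + (∑ i, (a i - ∑ k, q i k)) * M := by
  set r := ∑ i, (a i - ∑ k, q i k) with hr
  have key : ∑ i, ∑ j, (a i - ∑ k, q i k) * (b j - ∑ k, q k j) / r ≤ r := by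
    simp only [div_eq_mul_inv]
    simp_rw [← Finset.sum_mul, ← Finset.mul_sum]
    rw [← Finset.sum_mul, ← h.sum_residual_eq hab ha, ← hr, mul_assoc]
    exact mul_le_of_le_one_right zero_le (ENNReal.mul_inv_le_one _)
  calc ∑ i, ∑ j, completion q a b i j * c i j
      ≤ ∑ i, ∑ j, (q i j * c i j + (a i - ∑ k, q i k) * (b j - ∑ k, q k j) / r * M) := by
        refine Finset.sum_le_sum fun i _ => Finset.sum_le_sum fun j _ => ?_
        rw [completion, add_mul]
        gcongr
        exact hc i j
    _ = ∑ i, ∑ j, q i j * c i j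
          + (∑ i, ∑ j, (a i - ∑ k, q i k) * (b j - ∑ k, q k j) / r) * M := by
        simp_rw [Finset.sum_add_distrib, Finset.sum_mul]
    _ ≤ _ := by gcongr

lemma exists_rat_approx {x ε : ℝ≥0∞} (hx : x ≠ ∞) (hε : ε ≠ 0) :
    ∃ q : ℚ, (Real.toNNReal q : ℝ≥0∞) ≤ x ∧ x ≤ (Real.toNNReal q : ℝ≥0∞) + ε := by
  rcases eq_or_ne x 0 with rfl | h0
  · exact ⟨0, by simp⟩
  · obtain ⟨q, -, h1, h2⟩ := ENNReal.lt_iff_exists_rat_btwn.1 (ENNReal.sub_lt_self hx h0 hε)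
    exact ⟨q, h2.le, tsub_le_iff_right.1 h1.le⟩

end Matrices

section Gluing

variable {α ι : Type*} [MeasurableSpace α] [Fintype ι] [MeasurableSpace ι]
  [MeasurableSingletonClass ι]

/-- The measure on `α × α` with block masses `p` that is proportional to `μ ⊗ ν` on every product
of two fibres of `f`. -/
def glue (μ ν : Measure α) (f : α → ι) (p : ι → ι → ℝ≥0∞) : Measure (α × α) :=
  (μ.prod ν).withDensity
    fun z => p (f z.1) (f z.2) / (μ (f ⁻¹' {f z.1}) * ν (f ⁻¹' {f z.2}))

lemma lintegral_comp_of_fintype (μ : Measure α) {f : α → ι} (hf : Measurable f)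
    (h : ι → ℝ≥0∞) : ∫⁻ x, h (f x) ∂μ = ∑ i, h i * μ (f ⁻¹' {i}) := by
  rw [← lintegral_map (f := h) (measurable_of_countable _) hf, lintegral_fintype]
  simp [Measure.map_apply hf]

lemma measurable_glue_density (f : α → ι) (hf : Measurable f) (h : ι → ι → ℝ≥0∞) :
    Measurable fun z : α × α => h (f z.1) (f z.2) :=
  (measurable_of_countable fun w : ι × ι => h w.1 w.2).comp
    ((hf.comp measurable_fst).prodMk (hf.comp measurable_snd))

lemma ae_fiber_ne_zero (μ : Measure α) {f : α → ι} (hf : Measurable f) :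
    ∀ᵐ x ∂μ, μ (f ⁻¹' {f x}) ≠ 0 := by
  have : ∀ᵐ i ∂(μ.map f), μ (f ⁻¹' {i}) ≠ 0 := by
    rw [ae_iff_of_countable]
    intro i hi
    rwa [Measure.map_apply hf (measurableSet_singleton i)] at hi
  exact ae_of_ae_map hf.aemeasurable this

lemma lintegral_glue_le (μ ν : Measure α) [IsProbabilityMeasure μ] [IsProbabilityMeasure ν]
    {f : α → ι} (hf : Measurable f) (p c : ι → ι → ℝ≥0∞) :
    ∫⁻ z, c (f z.1) (f z.2) ∂(glue μ ν f p) ≤ ∑ i, ∑ j, p i j * c i j := by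
  rw [glue, lintegral_withDensity_eq_lintegral_mul _
    (measurable_glue_density f hf fun i j => p i j / (μ (f ⁻¹' {i}) * ν (f ⁻¹' {j})))
    (measurable_glue_density f hf c)]
  rw [lintegral_prod _ (by
    exact (measurable_glue_density f hf fun i j =>
      p i j / (μ (f ⁻¹' {i}) * ν (f ⁻¹' {j})) * c i j).aemeasurable)]
  simp only [Pi.mul_apply]
  have h1 : ∀ x, ∫⁻ x', p (f x) (f x') / (μ (f ⁻¹' {f x}) * ν (f ⁻¹' {f x'})) * c (f x) (f x') ∂ν
      = ∑ j, p (f x) j / (μ (f ⁻¹' {f x}) * ν (f ⁻¹' {j})) * c (f x) j * ν (f ⁻¹' {j}) := fun x =>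
    lintegral_comp_of_fintype ν hf
      fun j => p (f x) j / (μ (f ⁻¹' {f x}) * ν (f ⁻¹' {j})) * c (f x) j
  simp_rw [h1]
  rw [lintegral_comp_of_fintype μ hf
    fun i => ∑ j, p i j / (μ (f ⁻¹' {i}) * ν (f ⁻¹' {j})) * c i j * ν (f ⁻¹' {j})]
  refine Finset.sum_le_sum fun i _ => ?_
  rw [Finset.sum_mul]
  refine Finset.sum_le_sum fun j _ => ?_
  set A := μ (f ⁻¹' {i})
  set B := ν (f ⁻¹' {j})
  calc p i j / (A * B) * c i j * B * A = p i j * c i j * ((A * B) * (A * B)⁻¹) := by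
        rw [div_eq_mul_inv]; ring
    _ ≤ p i j * c i j := mul_le_of_le_one_right zero_le (ENNReal.mul_inv_le_one _)

lemma map_fst_glue (μ ν : Measure α) [IsProbabilityMeasure μ] [IsProbabilityMeasure ν]
    {f : α → ι} (hf : Measurable f) (p : ι → ι → ℝ≥0∞)
    (hp₁ : ∀ i, ∑ j, p i j = μ (f ⁻¹' {i})) (hp₂ : ∀ j, ∑ i, p i j = ν (f ⁻¹' {j})) :
    (glue μ ν f p).map Prod.fst = μ := by
  have hm := measurable_glue_density f hf fun i j => p i j / (μ (f ⁻¹' {i}) * ν (f ⁻¹' {j}))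
  refine Measure.ext fun s hs => ?_
  rw [Measure.map_apply measurable_fst hs, glue, withDensity_apply _ (measurable_fst hs),
    ← lintegral_indicator (measurable_fst hs),
    lintegral_prod _ (hm.indicator (measurable_fst hs)).aemeasurable, ← lintegral_indicator_one hs]
  refine lintegral_congr_ae ?_
  filter_upwards [ae_fiber_ne_zero μ hf] with x hx
  by_cases hxs : x ∈ s
  · have : ∀ x', (Prod.fst ⁻¹' s : Set (α × α)).indicator (fun z : α × α =>
        p (f z.1) (f z.2) / (μ (f ⁻¹' {f z.1}) * ν (f ⁻¹' {f z.2}))) (x, x')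
        = p (f x) (f x') / (μ (f ⁻¹' {f x}) * ν (f ⁻¹' {f x'})) := fun x' =>
      indicator_of_mem (s := (Prod.fst ⁻¹' s : Set (α × α))) (a := (x, x')) hxs _
    simp_rw [this]
    rw [lintegral_comp_of_fintype ν hf fun j => p (f x) j / (μ (f ⁻¹' {f x}) * ν (f ⁻¹' {j})),
      indicator_of_mem hxs, Pi.one_apply]
    have hA : μ (f ⁻¹' {f x}) ≠ ∞ := measure_ne_top _ _
    have h2 : ∀ j, p (f x) j / (μ (f ⁻¹' {f x}) * ν (f ⁻¹' {j})) * ν (f ⁻¹' {j})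
        = p (f x) j * (μ (f ⁻¹' {f x}))⁻¹ := by
      intro j
      rw [div_eq_mul_inv, ENNReal.mul_inv (Or.inl hx) (Or.inl hA), ← mul_assoc]
      refine ENNReal.inv_mul_cancel_right' (fun h0 => ?_) fun h0 => absurd h0 (measure_ne_top _ _)
      have : p (f x) j ≤ ν (f ⁻¹' {j}) := hp₂ j ▸
        Finset.single_le_sum (f := fun i => p i j) (fun _ _ => zero_le) (Finset.mem_univ (f x))
      rw [h0] at this
      simp [le_antisymm this zero_le]
    simp_rw [h2]
    rw [← Finset.sum_mul, hp₁, ENNReal.mul_inv_cancel hx hA]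
  · have : ∀ x', (Prod.fst ⁻¹' s : Set (α × α)).indicator (fun z : α × α =>
        p (f z.1) (f z.2) / (μ (f ⁻¹' {f z.1}) * ν (f ⁻¹' {f z.2}))) (x, x') = 0 := fun x' =>
      indicator_of_notMem (s := (Prod.fst ⁻¹' s : Set (α × α))) (a := (x, x')) hxs _
    simp [hxs]

lemma glue_map_swap (μ ν : Measure α) [IsProbabilityMeasure μ] [IsProbabilityMeasure ν]
    {f : α → ι} (hf : Measurable f) (p : ι → ι → ℝ≥0∞) :
    (glue μ ν f p).map Prod.swap = glue ν μ f fun i j => p j i := by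
  have hm := measurable_glue_density f hf fun i j => p i j / (μ (f ⁻¹' {i}) * ν (f ⁻¹' {j}))
  refine Measure.ext fun s hs => ?_
  rw [Measure.map_apply measurable_swap hs, glue, glue,
    withDensity_apply _ (measurable_swap hs), withDensity_apply _ hs,
    ← Measure.prod_swap (μ := ν) (ν := μ),
    setLIntegral_map (measurable_swap hs) hm measurable_swap, ← preimage_comp]
  simp [mul_comm]

lemma map_snd_glue (μ ν : Measure α) [IsProbabilityMeasure μ] [IsProbabilityMeasure ν]
    {f : α → ι} (hf : Measurable f) (p : ι → ι → ℝ≥0∞)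
    (hp₁ : ∀ i, ∑ j, p i j = μ (f ⁻¹' {i})) (hp₂ : ∀ j, ∑ i, p i j = ν (f ⁻¹' {j})) :
    (glue μ ν f p).map Prod.snd = ν := by
  have h := map_fst_glue ν μ hf (fun i j => p j i) hp₂ hp₁
  rwa [← glue_map_swap μ ν hf, Measure.map_map measurable_fst measurable_swap] at h

lemma glue_mem_couplings (μ ν : Measure α) [IsProbabilityMeasure μ] [IsProbabilityMeasure ν]
    {f : α → ι} (hf : Measurable f) (p : ι → ι → ℝ≥0∞)
    (hp₁ : ∀ i, ∑ j, p i j = μ (f ⁻¹' {i})) (hp₂ : ∀ j, ∑ i, p i j = ν (f ⁻¹' {j})) :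
    glue μ ν f p ∈ Couplings μ ν := by
  have h1 := map_fst_glue μ ν hf p hp₁ hp₂
  refine ⟨⟨?_⟩, h1, map_snd_glue μ ν hf p hp₁ hp₂⟩
  rw [← preimage_univ (f := Prod.fst), ← Measure.map_apply measurable_fst .univ, h1, measure_univ]

end Gluing

section Selection

variable {α β ι : Type*} [MeasurableSpace α] [MeasurableSpace β]

lemma lintegral_comp_coupling [Fintype ι] [MeasurableSpace ι] [MeasurableSingletonClass ι]
    (π : Measure (α × α)) {f : α → ι} (hf : Measurable f) (h : ι → ι → ℝ≥0∞) :
    ∫⁻ z, h (f z.1) (f z.2) ∂π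
      = ∑ i, ∑ j, π ((f ⁻¹' {i}) ×ˢ (f ⁻¹' {j})) * h i j := by
  have hF : Measurable fun z : α × α => (f z.1, f z.2) :=
    (hf.comp measurable_fst).prodMk (hf.comp measurable_snd)
  rw [lintegral_comp_of_fintype π hF fun w => h w.1 w.2, Fintype.sum_prod_type]
  refine Finset.sum_congr rfl fun i _ => Finset.sum_congr rfl fun j _ => ?_
  rw [mul_comm]
  congr 2
  ext z
  simp

lemma exists_kernel_eq_glue [Fintype ι] [MeasurableSpace ι] [MeasurableSingletonClass ι]
    (K₁ K₂ : Kernel β α) [IsMarkovKernel K₁] [IsMarkovKernel K₂]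
    {f : α → ι} (hf : Measurable f) (P : β → ι → ι → ℝ≥0∞)
    (hP : ∀ i j, Measurable fun y => P y i j) :
    ∃ κ : Kernel β (α × α), ∀ y, κ y = glue (K₁ y) (K₂ y) f (P y) := by
  have hF : Measurable fun w : β × (ι × ι) =>
      P w.1 w.2.1 w.2.2 / (K₁ w.1 (f ⁻¹' {w.2.1}) * K₂ w.1 (f ⁻¹' {w.2.2})) := by
    refine measurable_from_prod_countable_left fun w => ?_
    exact (hP w.1 w.2).div ((K₁.measurable_coe (hf (measurableSet_singleton w.1))).mul
      (K₂.measurable_coe (hf (measurableSet_singleton w.2))))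
  have hG : Measurable (Function.uncurry fun (y : β) (z : α × α) =>
      P y (f z.1) (f z.2) / (K₁ y (f ⁻¹' {f z.1}) * K₂ y (f ⁻¹' {f z.2}))) :=
    hF.comp (measurable_fst.prodMk
      ((hf.comp (measurable_fst.comp measurable_snd)).prodMk
        (hf.comp (measurable_snd.comp measurable_snd))))
  refine ⟨(K₁ ×ₖ K₂).withDensity fun y z =>
    P y (f z.1) (f z.2) / (K₁ y (f ⁻¹' {f z.1}) * K₂ y (f ⁻¹' {f z.2})), fun y => ?_⟩
  rw [Kernel.withDensity_apply _ hG, Kernel.prod_apply, glue]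

/-- The matrix `q` if it is a subcoupling of `a` and `b`, and `0` otherwise. -/
def subcouplingOrZero [Fintype ι] (q : ι → ι → ℝ≥0∞) (a b : ι → ℝ≥0∞) : ι → ι → ℝ≥0∞ :=
  open scoped Classical in if IsSubcoupling q a b then q else 0

lemma isSubcoupling_subcouplingOrZero [Fintype ι] (q : ι → ι → ℝ≥0∞) (a b : ι → ℝ≥0∞) :
    IsSubcoupling (subcouplingOrZero q a b) a b := by
  unfold subcouplingOrZero
  split_ifs with h
  · exact h
  · simp [IsSubcoupling]

lemma measurable_completion_subcouplingOrZero [Fintype ι] (q : ι → ι → ℝ≥0∞)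
    {a b : β → ι → ℝ≥0∞} (ha : ∀ i, Measurable fun y => a y i)
    (hb : ∀ i, Measurable fun y => b y i) (i j : ι) :
    Measurable fun y => completion (subcouplingOrZero q (a y) (b y)) (a y) (b y) i j := by
  have hset : MeasurableSet {y | IsSubcoupling q (a y) (b y)} := by
    have : {y | IsSubcoupling q (a y) (b y)}
        = (⋂ i, {y | ∑ j, q i j ≤ a y i}) ∩ ⋂ j, {y | ∑ i, q i j ≤ b y j} := by
      ext y
      simp [IsSubcoupling]
    rw [this]
    exact (MeasurableSet.iInter fun i => measurableSet_le measurable_const (ha i)).inter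
      (MeasurableSet.iInter fun j => measurableSet_le measurable_const (hb j))
  have hq : ∀ i j, Measurable fun y => subcouplingOrZero q (a y) (b y) i j := by
    intro i j
    have : (fun y => subcouplingOrZero q (a y) (b y) i j)
        = {y | IsSubcoupling q (a y) (b y)}.indicator fun _ => q i j := by
      classical
      ext y
      simp only [subcouplingOrZero, indicator, mem_ofPred_eq]
      split_ifs <;> rfl
    rw [this]
    exact measurable_const.indicator hset
  unfold completion
  fun_prop

lemma sum_measure_fiber [Fintype ι] [MeasurableSpace ι] [MeasurableSingletonClass ι]
    (μ : Measure α) [IsProbabilityMeasure μ] {f : α → ι} (hf : Measurable f) :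
    ∑ i, μ (f ⁻¹' {i}) = 1 := by
  have := lintegral_comp_of_fintype μ hf fun _ => 1
  simpa using this.symm

/-- Couplings are approximated, in the cost sense, by completions of rational subcouplings. -/
lemma exists_rat_glue_cost_le [Fintype ι] [MeasurableSpace ι] [MeasurableSingletonClass ι]
    {c : α → α → ℝ≥0∞} {f : α → ι} (hf : Measurable f) {S : Set α} {C : ι → ι → ℝ≥0∞}
    (hC : ∀ i j, C i j ≠ ∞) {η : ℝ≥0∞} (hη : η ≠ 0)
    (hcC : ∀ x ∈ S, ∀ x' ∈ S, c x x' ≤ C (f x) (f x'))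
    (hCc : ∀ x ∈ S, ∀ x' ∈ S, C (f x) (f x') ≤ c x x' + η)
    {μ ν : Measure α} [IsProbabilityMeasure μ] [IsProbabilityMeasure ν]
    (hμ : ∀ᵐ x ∂μ, x ∈ S) (hν : ∀ᵐ x ∂ν, x ∈ S) {π : Measure (α × α)} (hπ : π ∈ Couplings μ ν) :
    ∃ q : ι → ι → ℚ, ∫⁻ z, c z.1 z.2 ∂(glue μ ν f (completion
        (subcouplingOrZero (fun i j => (Real.toNNReal (q i j) : ℝ≥0∞))
          (fun i => μ (f ⁻¹' {i})) fun i => ν (f ⁻¹' {i}))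
        (fun i => μ (f ⁻¹' {i})) fun i => ν (f ⁻¹' {i})))
      ≤ ∫⁻ z, c z.1 z.2 ∂π + (η + η) := by
  obtain ⟨hπp, hπ₁, hπ₂⟩ := hπ
  set a : ι → ℝ≥0∞ := fun i => μ (f ⁻¹' {i}) with ha
  set b : ι → ℝ≥0∞ := fun i => ν (f ⁻¹' {i}) with hb
  have hsa : ∑ i, a i = 1 := sum_measure_fiber μ hf
  have hsb : ∑ i, b i = 1 := sum_measure_fiber ν hf
  set M : ℝ≥0∞ := ∑ i, ∑ j, C i j with hM
  have hMtop : M ≠ ∞ := ENNReal.sum_ne_top.2 fun i _ => ENNReal.sum_ne_top.2 fun j _ => hC i j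
  have hCM : ∀ i j, C i j ≤ M := fun i j =>
    (Finset.single_le_sum (f := fun j => C i j) (fun _ _ => zero_le) (Finset.mem_univ j)).trans
      (Finset.single_le_sum (f := fun i => ∑ j, C i j) (fun _ _ => zero_le) (Finset.mem_univ i))
  obtain ⟨ε, hε0, hε⟩ : ∃ ε : ℝ≥0∞, ε ≠ 0 ∧
      (∑ _i : ι, ∑ _j : ι, ε) * M ≤ η := by
    have hD : (Fintype.card ι * (Fintype.card ι * M) : ℝ≥0∞) ≠ ∞ := by finiteness
    refine ⟨η / (Fintype.card ι * (Fintype.card ι * M)), ENNReal.div_ne_zero.2 ⟨hη, hD⟩, ?_⟩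
    simp only [Finset.sum_const, Finset.card_univ, nsmul_eq_mul]
    set D : ℝ≥0∞ := Fintype.card ι * (Fintype.card ι * M) with hDdef
    calc (Fintype.card ι * (Fintype.card ι * (η / D))) * M = η * (D * D⁻¹) := by
          rw [div_eq_mul_inv]
          nth_rw 2 [hDdef]
          ring
      _ ≤ η := mul_le_of_le_one_right zero_le (ENNReal.mul_inv_le_one _)
  have hπtop : ∀ i j, π ((f ⁻¹' {i}) ×ˢ (f ⁻¹' {j})) ≠ ∞ := fun i j => measure_ne_top _ _
  choose q hq₁ hq₂ using fun i j => exists_rat_approx (hπtop i j) hε0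
  refine ⟨q, ?_⟩
  set Q : ι → ι → ℝ≥0∞ := fun i j => (Real.toNNReal (q i j) : ℝ≥0∞) with hQ
  have hrow : ∀ i, ∑ j, π ((f ⁻¹' {i}) ×ˢ (f ⁻¹' {j})) = a i := by
    intro i
    have := sum_measure_preimage_singleton (μ := π.restrict ((f ⁻¹' {i}) ×ˢ univ)) Finset.univ
      (f := f ∘ Prod.snd)
      fun j _ => (hf.comp measurable_snd) (measurableSet_singleton j)
    simp only [ha, ← hπ₁]
    rw [Measure.map_apply measurable_fst (hf (measurableSet_singleton i))]
    simp only [Finset.coe_univ, preimage_univ, Measure.restrict_apply_univ] at this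
    rw [prod_univ] at this
    rw [← this]
    refine Finset.sum_congr rfl fun j _ => ?_
    rw [Measure.restrict_apply ((hf.comp measurable_snd) (measurableSet_singleton j))]
    congr 1
    ext z
    simp [and_comm]
  have hcol : ∀ j, ∑ i, π ((f ⁻¹' {i}) ×ˢ (f ⁻¹' {j})) = b j := by
    intro j
    have := sum_measure_preimage_singleton (μ := π.restrict (univ ×ˢ (f ⁻¹' {j}))) Finset.univ
      (f := f ∘ Prod.fst)
      fun i _ => (hf.comp measurable_fst) (measurableSet_singleton i)
    simp only [hb, ← hπ₂]
    rw [Measure.map_apply measurable_snd (hf (measurableSet_singleton j))]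
    simp only [Finset.coe_univ, preimage_univ, Measure.restrict_apply_univ] at this
    rw [univ_prod] at this
    rw [← this]
    refine Finset.sum_congr rfl fun i _ => ?_
    rw [Measure.restrict_apply ((hf.comp measurable_fst) (measurableSet_singleton i))]
    congr 1
  have hsub : IsSubcoupling Q a b :=
    ⟨fun i => hrow i ▸ Finset.sum_le_sum fun j _ => hq₁ i j,
      fun j => hcol j ▸ Finset.sum_le_sum fun i _ => hq₁ i j⟩
  have hor : subcouplingOrZero Q a b = Q := if_pos hsub
  rw [hor]
  have hres : ∑ i, (a i - ∑ k, Q i k) ≤ ∑ _i : ι, ∑ _j : ι, ε := by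
    refine Finset.sum_le_sum fun i _ => ?_
    rw [tsub_le_iff_left, ← Finset.sum_add_distrib, ← hrow i]
    exact Finset.sum_le_sum fun j _ => hq₂ i j
  have hglue : ∀ᵐ z ∂(glue μ ν f (completion Q a b)), z.1 ∈ S ∧ z.2 ∈ S :=
    (withDensity_absolutelyContinuous _ _).ae_le
      ((Measure.quasiMeasurePreserving_fst.ae hμ).and (Measure.quasiMeasurePreserving_snd.ae hν))
  have hπS : ∀ᵐ z ∂π, z.1 ∈ S ∧ z.2 ∈ S := by
    rw [← hπ₁] at hμ
    rw [← hπ₂] at hν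
    exact (ae_of_ae_map measurable_fst.aemeasurable hμ).and
      (ae_of_ae_map measurable_snd.aemeasurable hν)
  calc ∫⁻ z, c z.1 z.2 ∂(glue μ ν f (completion Q a b))
      ≤ ∫⁻ z, C (f z.1) (f z.2) ∂(glue μ ν f (completion Q a b)) :=
        lintegral_mono_ae (hglue.mono fun z hz => hcC _ hz.1 _ hz.2)
    _ ≤ ∑ i, ∑ j, completion Q a b i j * C i j := lintegral_glue_le μ ν hf _ _
    _ ≤ ∑ i, ∑ j, Q i j * C i j + (∑ i, (a i - ∑ k, Q i k)) * M :=
        sum_completion_mul_le hsub (hsa.trans hsb.symm) (by simp [hsa]) hCM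
    _ ≤ ∑ i, ∑ j, π ((f ⁻¹' {i}) ×ˢ (f ⁻¹' {j})) * C i j + η := by
        gcongr with i _ j _
        · exact hq₁ i j
        · exact (mul_le_mul_left hres M).trans hε
    _ = ∫⁻ z, C (f z.1) (f z.2) ∂π + η := by rw [lintegral_comp_coupling π hf]
    _ ≤ ∫⁻ z, (c z.1 z.2 + η) ∂π + η := by
        gcongr 1
        exact lintegral_mono_ae (hπS.mono fun z hz => hCc _ hz.1 _ hz.2)
    _ = ∫⁻ z, c z.1 z.2 ∂π + (η + η) := by
        rw [lintegral_add_right _ measurable_const, lintegral_const, measure_univ, mul_one,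
          add_assoc]

lemma exists_kernel_nearly_optimal_of_seq {K₁ K₂ : Kernel β α} {c : α → α → ℝ≥0∞}
    (hc : Measurable (Function.uncurry c)) (κ : ℕ → Kernel β (α × α))
    (hκ : ∀ n y, κ n y ∈ Couplings (K₁ y) (K₂ y)) {ε : ℝ≥0∞} (hε : ε ≠ 0) :
    ∃ κ' : Kernel β (α × α), ∀ y, κ' y ∈ Couplings (K₁ y) (K₂ y) ∧
      ∀ n, ∫⁻ z, c z.1 z.2 ∂(κ' y) ≤ ∫⁻ z, c z.1 z.2 ∂(κ n y) + ε := by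
  classical
  have hcost : ∀ n, Measurable fun y => ∫⁻ z, c z.1 z.2 ∂(κ n y) := fun n =>
    Measurable.lintegral_kernel (f := fun z : α × α => c z.1 z.2) hc
  have hex : ∀ y, ∃ n, ∫⁻ z, c z.1 z.2 ∂(κ n y) ≤ (⨅ m, ∫⁻ z, c z.1 z.2 ∂(κ m y)) + ε := by
    intro y
    by_cases htop : (⨅ m, ∫⁻ z, c z.1 z.2 ∂(κ m y)) = ∞
    · exact ⟨0, by simp [htop]⟩
    · obtain ⟨n, hn⟩ := iInf_lt_iff.1 (ENNReal.lt_add_right htop hε)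
      exact ⟨n, hn.le⟩
  have hN : Measurable fun y => Nat.find (hex y) := measurable_find hex fun n =>
    measurableSet_le (hcost n) ((Measurable.iInf hcost).add_const ε)
  have hm : Measurable fun w : ℕ × β => κ w.1 w.2 :=
    measurable_from_prod_countable_right fun n => (κ n).measurable
  refine ⟨⟨fun y => κ (Nat.find (hex y)) y, hm.comp (hN.prodMk measurable_id)⟩, fun y => ?_⟩
  refine ⟨hκ _ _, fun n => (Nat.find_spec (hex y)).trans ?_⟩
  gcongr
  exact iInf_le _ n

/-- Measurable selection of nearly optimal couplings along two Markov kernels, for a cost that is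
approximated by a function of finitely many measurable cells. -/
lemma exists_kernel_nearly_optimal [Fintype ι] [MeasurableSpace ι] [MeasurableSingletonClass ι]
    {c : α → α → ℝ≥0∞} (hc : Measurable (Function.uncurry c))
    {f : α → ι} (hf : Measurable f) {S : Set α} {C : ι → ι → ℝ≥0∞}
    (hC : ∀ i j, C i j ≠ ∞) {η : ℝ≥0∞} (hη : η ≠ 0)
    (hcC : ∀ x ∈ S, ∀ x' ∈ S, c x x' ≤ C (f x) (f x'))
    (hCc : ∀ x ∈ S, ∀ x' ∈ S, C (f x) (f x') ≤ c x x' + η)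
    (K₁ K₂ : Kernel β α) [IsMarkovKernel K₁] [IsMarkovKernel K₂] :
    ∃ κ : Kernel β (α × α), ∀ y, κ y ∈ Couplings (K₁ y) (K₂ y) ∧
      ((∀ᵐ x ∂(K₁ y), x ∈ S) → (∀ᵐ x ∂(K₂ y), x ∈ S) →
        ∫⁻ z, c z.1 z.2 ∂(κ y) ≤ transportCost c (K₁ y) (K₂ y) + (η + η + η)) := by
  obtain ⟨e, he⟩ := exists_surjective_nat (ι → ι → ℚ)
  have hK : ∀ (K : Kernel β α) i, Measurable fun y => K y (f ⁻¹' {i}) := fun K i =>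
    K.measurable_coe (hf (measurableSet_singleton i))
  choose κ hκ using fun n => exists_kernel_eq_glue K₁ K₂ hf _
    (measurable_completion_subcouplingOrZero
      (fun i j => (Real.toNNReal (e n i j) : ℝ≥0∞)) (hK K₁) (hK K₂))
  have hcoup : ∀ n y, κ n y ∈ Couplings (K₁ y) (K₂ y) := by
    intro n y
    have h1 := sum_measure_fiber (K₁ y) hf
    have h2 := sum_measure_fiber (K₂ y) hf
    have hs := isSubcoupling_subcouplingOrZero
      (fun i j => (Real.toNNReal (e n i j) : ℝ≥0∞))
      (fun i => K₁ y (f ⁻¹' {i})) (fun i => K₂ y (f ⁻¹' {i}))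
    rw [hκ]
    exact glue_mem_couplings _ _ hf _
      (hs.sum_completion_right (h1.trans h2.symm) (by simp [h1]))
      (hs.sum_completion_left (h1.trans h2.symm) (by simp [h1]))
  obtain ⟨κ', hκ'⟩ := exists_kernel_nearly_optimal_of_seq hc κ hcoup hη
  refine ⟨κ', fun y => ⟨(hκ' y).1, fun hS₁ hS₂ => ?_⟩⟩
  rw [transportCost, ENNReal.iInf_add]
  refine le_iInf fun π => ?_
  rw [ENNReal.iInf_add]
  refine le_iInf fun hπ => ?_
  obtain ⟨q, hq⟩ := exists_rat_glue_cost_le hf hC hη hcC hCc hS₁ hS₂ hπ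
  obtain ⟨n, rfl⟩ := he q
  refine ((hκ' y).2 n).trans ?_
  rw [← hκ] at hq
  rw [← add_assoc]
  gcongr

end Selection

section Quantization

open TopologicalSpace

lemma IsCompact.exists_finite_quantization {E : Type*} [PseudoMetricSpace E] [SeparableSpace E]
    [Nonempty E] [MeasurableSpace E] [OpensMeasurableSpace E] {X : Set E} (hX : IsCompact X)
    {δ : ℝ} (hδ : 0 < δ) :
    ∃ (n : ℕ) (f : E → Fin n) (z : Fin n → E), Measurable f ∧ ∀ x ∈ X, dist (z (f x)) x < δ := by
  obtain ⟨t, ht⟩ := hX.elim_finite_subcover (fun k => Metric.ball (denseSeq E k) δ)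
    (fun k => Metric.isOpen_ball) fun x _ => by
      obtain ⟨k, hk⟩ := (denseRange_denseSeq E).exists_dist_lt x hδ
      exact mem_iUnion.2 ⟨k, hk⟩
  set N := t.sup id
  refine ⟨N + 1, fun x => ⟨SimpleFunc.nearestPtInd (denseSeq E) N x,
    Nat.lt_succ_of_le (SimpleFunc.nearestPtInd_le _ _ _)⟩, fun i => denseSeq E i, ?_, ?_⟩
  · refine measurable_to_countable' fun i => ?_
    convert SimpleFunc.measurableSet_fiber (SimpleFunc.nearestPtInd (denseSeq E) N) i using 1
    ext x
    simp [Fin.ext_iff]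
  · intro x hx
    obtain ⟨k, hkt, hk⟩ := mem_iUnion₂.1 (ht hx)
    have h := SimpleFunc.edist_nearestPt_le (denseSeq E) x (Finset.le_sup (f := id) hkt)
    rw [edist_dist, edist_dist, ENNReal.ofReal_le_ofReal_iff dist_nonneg] at h
    exact h.trans_lt (by rwa [dist_comm])

lemma IsCompact.exists_finite_sq_edist_approx {E : Type*} [PseudoMetricSpace E] [SeparableSpace E]
    [Nonempty E] [MeasurableSpace E] [OpensMeasurableSpace E] {X : Set E} (hX : IsCompact X)
    {η : ℝ≥0∞} (hη : η ≠ 0) :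
    ∃ (n : ℕ) (f : E → Fin n) (C : Fin n → Fin n → ℝ≥0∞), Measurable f ∧ (∀ i j, C i j ≠ ∞) ∧
      (∀ x ∈ X, ∀ x' ∈ X, edist x x' ^ 2 ≤ C (f x) (f x')) ∧
      ∀ x ∈ X, ∀ x' ∈ X, C (f x) (f x') ≤ edist x x' ^ 2 + η := by
  obtain ⟨r, hr0, hr⟩ : ∃ r : ℝ, 0 < r ∧ ENNReal.ofReal r ≤ η := by
    obtain ⟨r, hr0, hr⟩ := ENNReal.lt_iff_exists_real_btwn.1 (pos_iff_ne_zero.2 hη)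
    exact ⟨r, ENNReal.ofReal_pos.1 hr.1, hr.2.le⟩
  set D := Metric.diam X
  have hD : 0 ≤ D := Metric.diam_nonneg
  obtain ⟨δ, hδ0, hδ1, hδ⟩ : ∃ δ : ℝ, 0 < δ ∧ δ ≤ 1 ∧ 4 * δ * (D + 1) * 2 ≤ r := by
    refine ⟨min 1 (r / (8 * (D + 1))), by positivity, min_le_left _ _, ?_⟩
    have : min 1 (r / (8 * (D + 1))) ≤ r / (8 * (D + 1)) := min_le_right _ _
    rw [le_div_iff₀ (by positivity)] at this
    linarith
  obtain ⟨n, f, z, hf, hz⟩ := hX.exists_finite_quantization hδ0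
  have key : ∀ x ∈ X, ∀ x' ∈ X,
      |dist (z (f x)) (z (f x')) - dist x x'| ≤ 2 * δ ∧ dist x x' ≤ D := by
    intro x hx x' hx'
    refine ⟨?_, Metric.dist_le_diam_of_mem hX.isBounded hx hx'⟩
    have := dist_dist_dist_le (z (f x)) (z (f x')) x x'
    rw [Real.dist_eq] at this
    linarith [hz x hx, hz x' hx']
  refine ⟨n, f, fun i j => ENNReal.ofReal (dist (z i) (z j) ^ 2 + 4 * δ * (D + 1)), hf,
    fun i j => ENNReal.ofReal_ne_top, ?_, ?_⟩
  · intro x hx x' hx'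
    obtain ⟨h1, h2⟩ := key x hx x' hx'
    rw [edist_dist, ← ENNReal.ofReal_pow dist_nonneg]
    refine ENNReal.ofReal_le_ofReal ?_
    rw [abs_le] at h1
    have h3 : 0 ≤ dist x x' := dist_nonneg
    have h4 : 0 ≤ dist (z (f x)) (z (f x')) := dist_nonneg
    rcases le_total (dist x x') (dist (z (f x)) (z (f x'))) with h | h <;> nlinarith
  · intro x hx x' hx'
    obtain ⟨h1, h2⟩ := key x hx x' hx'
    refine le_trans ?_ (add_le_add_right hr _)
    rw [edist_dist, ← ENNReal.ofReal_pow dist_nonneg, ← ENNReal.ofReal_add (by positivity) hr0.le]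
    refine ENNReal.ofReal_le_ofReal ?_
    rw [abs_le] at h1
    have h3 : 0 ≤ dist x x' := dist_nonneg
    have h4 : 0 ≤ dist (z (f x)) (z (f x')) := dist_nonneg
    nlinarith

end Quantization

section Disintegration

variable {α β : Type*} [MeasurableSpace α] [MeasurableSpace β]

lemma IsDisint.map_swap {ν : Measure β} [IsProbabilityMeasure ν] {ρ : Measure (α × β)}
    [IsFiniteMeasure ρ] {K : Kernel β α} (h : IsDisint ν ρ K) : ρ.map Prod.swap = ν ⊗ₘ K := by
  have := h.1
  refine Measure.ext_prod fun {t s} ht hs => ?_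
  rw [Measure.map_apply measurable_swap (ht.prod hs), Measure.compProd_apply_prod ht hs,
    preimage_swap_prod, h.2 s t hs ht]

lemma IsDisint.ae_mem {ν : Measure β} [IsProbabilityMeasure ν] {ρ : Measure (α × β)}
    [IsFiniteMeasure ρ] {K : Kernel β α} (h : IsDisint ν ρ K) {X : Set α} (hX : MeasurableSet X)
    {Y : Set β} (hρ : ρ (X ×ˢ Y)ᶜ = 0) : ∀ᵐ y ∂ν, ∀ᵐ x ∂(K y), x ∈ X := by
  have h0 : ρ (Xᶜ ×ˢ univ) = 0 := measure_mono_null (t := (X ×ˢ Y)ᶜ) (fun z hz hz' => hz.1 hz'.1) hρ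
  rw [h.2 _ _ hX.compl .univ, Measure.restrict_univ,
    lintegral_eq_zero_iff (K.measurable_coe hX.compl)] at h0
  filter_upwards [h0] with y hy
  exact mem_ae_iff.2 hy

lemma lintegral_transportCost_le [StandardBorelSpace α] [Nonempty α]
    {ν : Measure β} [IsProbabilityMeasure ν] {ρ₁ ρ₂ : Measure (α × β)} [IsProbabilityMeasure ρ₁]
    [IsFiniteMeasure ρ₂] {K₁ K₂ : Kernel β α} (h₁ : IsDisint ν ρ₁ K₁) (h₂ : IsDisint ν ρ₂ K₂)
    {c : α → α → ℝ≥0∞} (hc : Measurable (Function.uncurry c)) {γ : Measure (α × α × β)}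
    (hγ₁ : γ.map (fun p => (p.1, p.2.2)) = ρ₁) (hγ₂ : γ.map (fun p => p.2) = ρ₂) :
    ∫⁻ y, transportCost c (K₁ y) (K₂ y) ∂ν ≤ ∫⁻ p, c p.1 p.2.1 ∂γ := by
  have := h₁.1
  have := h₂.1
  have hr : Measurable fun p : α × α × β => (p.2.2, (p.1, p.2.1)) := by fun_prop
  have hγp : IsProbabilityMeasure γ := ⟨by
    rw [← preimage_univ (f := fun p : α × α × β => (p.1, p.2.2)),
      ← Measure.map_apply (by fun_prop) .univ, hγ₁, measure_univ]⟩
  set γ' : Measure (β × α × α) := γ.map fun p => (p.2.2, (p.1, p.2.1)) with hγ'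
  have : IsProbabilityMeasure γ' := Measure.isProbabilityMeasure_map hr.aemeasurable
  have hm₁ : γ'.map (Prod.map id Prod.fst) = ν ⊗ₘ K₁ := by
    rw [← h₁.map_swap, ← hγ₁, hγ', Measure.map_map (by fun_prop) hr,
      Measure.map_map measurable_swap (by fun_prop)]
    rfl
  have hm₂ : γ'.map (Prod.map id Prod.snd) = ν ⊗ₘ K₂ := by
    rw [← h₂.map_swap, ← hγ₂, hγ', Measure.map_map (by fun_prop) hr,
      Measure.map_map measurable_swap (by fun_prop)]
    rfl
  have hfst : γ'.fst = ν := by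
    have h : (γ'.map (Prod.map id Prod.fst)).fst = γ'.fst :=
      Measure.map_map measurable_fst (by fun_prop)
    rw [← h, hm₁, Measure.fst_compProd]
  have hdis : ν ⊗ₘ γ'.condKernel = γ' := by
    conv_rhs => rw [← γ'.disintegrate γ'.condKernel, hfst]
  have hae₁ : γ'.condKernel.map Prod.fst =ᵐ[ν] K₁ := by
    refine Kernel.ae_eq_of_compProd_eq ?_
    rw [Measure.compProd_map measurable_fst, hdis, hm₁]
  have hae₂ : γ'.condKernel.map Prod.snd =ᵐ[ν] K₂ := by
    refine Kernel.ae_eq_of_compProd_eq ?_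
    rw [Measure.compProd_map measurable_snd, hdis, hm₂]
  calc ∫⁻ y, transportCost c (K₁ y) (K₂ y) ∂ν
      ≤ ∫⁻ y, ∫⁻ z, c z.1 z.2 ∂(γ'.condKernel y) ∂ν := by
        refine lintegral_mono_ae ?_
        filter_upwards [hae₁, hae₂] with y hy₁ hy₂
        rw [Kernel.map_apply _ measurable_fst] at hy₁
        rw [Kernel.map_apply _ measurable_snd] at hy₂
        exact iInf₂_le _ ⟨inferInstance, hy₁, hy₂⟩
    _ = ∫⁻ w, c w.2.1 w.2.2 ∂γ' := by
        conv_rhs => rw [← hdis]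
        rw [Measure.lintegral_compProd]
        exact hc.comp measurable_snd
    _ = ∫⁻ p, c p.1 p.2.1 ∂γ := lintegral_map (hc.comp measurable_snd) hr

lemma exists_measure_of_couplings {ν : Measure β} [IsProbabilityMeasure ν]
    {ρ₁ ρ₂ : Measure (α × β)} [IsFiniteMeasure ρ₁] [IsFiniteMeasure ρ₂] {K₁ K₂ : Kernel β α}
    (h₁ : IsDisint ν ρ₁ K₁) (h₂ : IsDisint ν ρ₂ K₂)
    {c : α → α → ℝ≥0∞} (hc : Measurable (Function.uncurry c)) (κ : Kernel β (α × α))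
    (hκ : ∀ y, κ y ∈ Couplings (K₁ y) (K₂ y)) :
    ∃ γ : Measure (α × α × β), γ.map (fun p => (p.1, p.2.2)) = ρ₁ ∧ γ.map (fun p => p.2) = ρ₂ ∧
      ∫⁻ p, c p.1 p.2.1 ∂γ = ∫⁻ y, ∫⁻ z, c z.1 z.2 ∂(κ y) ∂ν := by
  have := h₁.1
  have := h₂.1
  have : IsMarkovKernel κ := ⟨fun y => (hκ y).1⟩
  have hr : Measurable fun w : β × α × α => (w.2.1, w.2.2, w.1) := by fun_prop
  have hk₁ : κ.map Prod.fst = K₁ := by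
    ext1 y
    rw [Kernel.map_apply _ measurable_fst, (hκ y).2.1]
  have hk₂ : κ.map Prod.snd = K₂ := by
    ext1 y
    rw [Kernel.map_apply _ measurable_snd, (hκ y).2.2]
  have hs : ∀ ρ : Measure (α × β), ρ = (ρ.map Prod.swap).map Prod.swap := fun ρ => by
    rw [Measure.map_map measurable_swap measurable_swap, Prod.swap_swap_eq, Measure.map_id]
  refine ⟨(ν ⊗ₘ κ).map fun w => (w.2.1, w.2.2, w.1), ?_, ?_, ?_⟩
  · rw [hs ρ₁, h₁.map_swap, ← hk₁, Measure.compProd_map measurable_fst,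
      Measure.map_map (by fun_prop) hr, Measure.map_map measurable_swap (by fun_prop)]
    rfl
  · rw [hs ρ₂, h₂.map_swap, ← hk₂, Measure.compProd_map measurable_snd,
      Measure.map_map (by fun_prop) hr, Measure.map_map measurable_swap (by fun_prop)]
    rfl
  · have hc' : Measurable fun p : α × α × β => c p.1 p.2.1 :=
      hc.comp (measurable_fst.prodMk (measurable_fst.comp measurable_snd))
    exact (lintegral_map hc' hr).trans (Measure.lintegral_compProd (hc'.comp hr))

end Disintegration

/-- for `ρ₁, ρ₂` probability measures on `X × Y` with second marginal `ν`,
one of them absolutely continuous w.r.t. `𝓛 ⊗ ν`, the integral `∫_Y W(ρ_{1,y}, ρ_{2,y})² dν(y)`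
(with `(ρ_{i,y})_y` the disintegrations w.r.t. `ν`) equals the infimum over nonnegative measures
`γ` on `X × X × Y` with `P₁₃ γ = ρ₁` and `P₂₃ γ = ρ₂` of `∫ |x - x'|² dγ(x, x', y)`. -/
theorem stmt0 {d d' : ℕ} (X : Set (Euc d)) (Y : Set (Euc d'))
    (hX : IsCompact X) (hXne : X.Nonempty) (hY : IsCompact Y) (hYne : Y.Nonempty)
    (ν : Measure (Euc d')) [IsProbabilityMeasure ν] (hνY : ν Yᶜ = 0)
    (ρ₁ ρ₂ : Measure (Euc d × Euc d'))
    [IsProbabilityMeasure ρ₁] [IsProbabilityMeasure ρ₂]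
    (hρ₁supp : ρ₁ ((X ×ˢ Y)ᶜ) = 0) (hρ₂supp : ρ₂ ((X ×ˢ Y)ᶜ) = 0)
    (hρ₁marg : ρ₁.map Prod.snd = ν) (hρ₂marg : ρ₂.map Prod.snd = ν)
    (hac : ρ₁ ≪ (volume.restrict X).prod ν ∨ ρ₂ ≪ (volume.restrict X).prod ν)
    (K₁ K₂ : Kernel (Euc d') (Euc d))
    (hK₁ : IsDisint ν ρ₁ K₁) (hK₂ : IsDisint ν ρ₂ K₂) :
    ∫⁻ y, W2sq (K₁ y) (K₂ y) ∂ν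
      = ⨅ γ ∈ {γ : Measure (Euc d × Euc d × Euc d') |
            γ.map (fun p => (p.1, p.2.2)) = ρ₁ ∧ γ.map (fun p => p.2) = ρ₂},
          ∫⁻ p, edist p.1 p.2.1 ^ 2 ∂γ := by
  have hM₁ := hK₁.1
  have hM₂ := hK₂.1
  have hc : Measurable (Function.uncurry fun a b : Euc d => edist a b ^ 2) :=
    measurable_edist.pow_const 2
  refine le_antisymm (le_iInf₂ fun γ hγ =>
    lintegral_transportCost_le hK₁ hK₂ hc hγ.1 hγ.2) ?_
  refine ENNReal.le_of_forall_pos_le_add fun ε hε _ => ?_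
  have hη : (ε : ℝ≥0∞) / 3 ≠ 0 := by simp [hε.ne']
  obtain ⟨n, f, C, hf, hC, h₁, h₂⟩ := hX.exists_finite_sq_edist_approx hη
  obtain ⟨κ, hκ⟩ := exists_kernel_nearly_optimal hc hf hC hη h₁ h₂ K₁ K₂
  obtain ⟨γ, hγ₁, hγ₂, hγ⟩ := exists_measure_of_couplings hK₁ hK₂ hc κ fun y => (hκ y).1
  refine (iInf₂_le γ ⟨hγ₁, hγ₂⟩).trans (hγ.trans_le ?_)
  calc ∫⁻ y, ∫⁻ z, edist z.1 z.2 ^ 2 ∂(κ y) ∂ν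
      ≤ ∫⁻ y, (W2sq (K₁ y) (K₂ y) + ε) ∂ν := by
        refine lintegral_mono_ae ?_
        filter_upwards [hK₁.ae_mem hX.measurableSet hρ₁supp,
          hK₂.ae_mem hX.measurableSet hρ₂supp] with y hy₁ hy₂
        have h := (hκ y).2 hy₁ hy₂
        rwa [ENNReal.add_thirds] at h
    _ = ∫⁻ y, W2sq (K₁ y) (K₂ y) ∂ν + ε := by
        rw [lintegral_add_right _ measurable_const, lintegral_const, measure_univ, mul_one]

end
end

section
/- Let ρ₁ and ρ₂ be probability measures on X×Y whose second marginal equals ν. Then the infimum, over nonnegative measures γ on X×X×Y whose pushforward under (x,x',y)↦(x,y) equals ρ₁ and whose pushforward under (x,x',y)↦(x',y) equals ρ₂, of ∫ |x−x'|² dγ(x,x',y), equals the infimum, over couplings γ̃ of ρ₁ and ρ₂ (probability measures on (X×Y)×(X×Y) with marginals ρ₁ and ρ₂) that are concentrated on the set {((x,y),(x',y')) : y = y'}, of ∫ |(x,y)−(x',y')|² dγ̃(x,y,x',y'). -/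
open MeasureTheory ProbabilityTheory Filter Set
open scoped ENNReal Topology

noncomputable section

/-- for `ρ₁, ρ₂` probability measures on `X × Y` with second marginal `ν`, the
infimum over nonnegative measures `γ` on `X × X × Y` with `P₁₃ γ = ρ₁`, `P₂₃ γ = ρ₂` of
`∫ |x−x'|² dγ(x,x',y)` equals the infimum over couplings `γ̃` of `ρ₁` and `ρ₂` concentrated on
`{((x,y),(x',y')) : y = y'}` of `∫ |(x,y)−(x',y')|² dγ̃`, where `|(x,y)−(x',y')|²` is the squared
Euclidean distance `|x−x'|² + |y−y'|²` on the product. -/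
theorem stmt1 {d d' : ℕ} (X : Set (Euc d)) (Y : Set (Euc d'))
    (hX : IsCompact X) (hXne : X.Nonempty) (hY : IsCompact Y) (hYne : Y.Nonempty)
    (ν : Measure (Euc d')) [IsProbabilityMeasure ν] (hνY : ν Yᶜ = 0)
    (ρ₁ ρ₂ : Measure (Euc d × Euc d'))
    [IsProbabilityMeasure ρ₁] [IsProbabilityMeasure ρ₂]
    (hρ₁supp : ρ₁ ((X ×ˢ Y)ᶜ) = 0) (hρ₂supp : ρ₂ ((X ×ˢ Y)ᶜ) = 0)
    (hρ₁marg : ρ₁.map Prod.snd = ν) (hρ₂marg : ρ₂.map Prod.snd = ν) :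
    (⨅ γ ∈ {γ : Measure (Euc d × Euc d × Euc d') |
          γ.map (fun p => (p.1, p.2.2)) = ρ₁ ∧ γ.map (fun p => p.2) = ρ₂},
        ∫⁻ p, edist p.1 p.2.1 ^ 2 ∂γ)
      = ⨅ γ' ∈ {γ' : Measure ((Euc d × Euc d') × (Euc d × Euc d')) |
            γ' ∈ Couplings ρ₁ ρ₂ ∧ γ' {q | q.1.2 ≠ q.2.2} = 0},
          ∫⁻ q, (edist q.1.1 q.2.1 ^ 2 + edist q.1.2 q.2.2 ^ 2) ∂γ' := by
  apply le_antisymm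
  · refine le_iInf₂ fun γ' hγ' => ?_
    obtain ⟨⟨_, h₁, h₂⟩, hdiag⟩ := hγ'
    have hS : Measurable fun q : (Euc d × Euc d') × (Euc d × Euc d') =>
        (q.1.1, q.2.1, q.2.2) := by fun_prop
    refine iInf₂_le_of_le (γ'.map fun q => (q.1.1, q.2.1, q.2.2)) ⟨?_, ?_⟩ ?_
    · rw [Measure.map_map (by fun_prop) hS, ← h₁]
      refine Measure.map_congr ?_
      have hae : ∀ᵐ q ∂γ', q.1.2 = q.2.2 := hdiag
      filter_upwards [hae] with q hq
      exact Prod.ext rfl hq.symm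
    · rw [Measure.map_map (by fun_prop) hS, ← h₂]
      rfl
    · rw [lintegral_map (by fun_prop) hS]
      exact lintegral_mono fun q => le_self_add
  · refine le_iInf₂ fun γ hγ => ?_
    obtain ⟨h₁, h₂⟩ := hγ
    have hT : Measurable fun p : Euc d × Euc d × Euc d' => ((p.1, p.2.2), p.2) := by fun_prop
    have hfst : (γ.map fun p => ((p.1, p.2.2), p.2)).map Prod.fst = ρ₁ := by
      rw [Measure.map_map measurable_fst hT, ← h₁]
      rfl
    have hsnd : (γ.map fun p => ((p.1, p.2.2), p.2)).map Prod.snd = ρ₂ := by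
      rw [Measure.map_map measurable_snd hT, ← h₂]
      rfl
    refine iInf₂_le_of_le (γ.map fun p => ((p.1, p.2.2), p.2)) ⟨⟨⟨?_⟩, hfst, hsnd⟩, ?_⟩ ?_
    · have huniv := congrArg (fun μ => μ univ) hfst
      simpa [Measure.map_apply measurable_fst MeasurableSet.univ] using huniv
    · have hdiag : MeasurableSet {q : (Euc d × Euc d') × (Euc d × Euc d') | q.1.2 ≠ q.2.2} :=
        (measurableSet_eq_fun (by fun_prop) (by fun_prop)).compl
      rw [Measure.map_apply hT hdiag]
      simp
    · rw [lintegral_map (by fun_prop) hT]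
      simp

end
end

section
/- Let V ∈ C(X×Y) be nonnegative, κ > 0, ν a probability measure on Y, and μ a probability measure on X with Lebesgue density bounded above and bounded away from zero. Then the entropic optimal transport energy E(ρ) = ∫_{X×Y} V dρ + κ H(ρ|ν) admits a unique minimizer ρ_* over the set Γ(μ,ν) of couplings of μ and ν. -/
open MeasureTheory ProbabilityTheory Filter Set
open scoped ENNReal Topology

noncomputable section

/-- The integrand `s ↦ s log s − s + 1` of the entropy. -/
def entT (s : ℝ) : ℝ := s * Real.log s - s + 1

open scoped Classical in
/-- Weighted negative entropy of `ρ` relative to the reference measure `π`: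
`∫ (r log r − r + 1) dπ` if `ρ ≪ π` with density `r`, and `+∞` otherwise. -/
noncomputable def entropyH {α : Type*} [MeasurableSpace α] (π ρ : Measure α) : ℝ≥0∞ :=
  if ρ ≪ π then ∫⁻ p, ENNReal.ofReal (entT ((ρ.rnDeriv π p).toReal)) ∂π else ⊤

/-- The reference measure `𝓛|X ⊗ ν` on `X × Y`. -/
noncomputable def Lref {d d' : ℕ} (X : Set (Euc d)) (ν : Measure (Euc d')) :
    Measure (Euc d × Euc d') :=
  (MeasureTheory.volume.restrict X).prod ν

/-- The entropic optimal transport energy `E(ρ) = ∫ V dρ + κ H(ρ|ν)`. -/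
noncomputable def energyE {d d' : ℕ} (X : Set (Euc d)) (ν : Measure (Euc d'))
    (V : Euc d × Euc d' → ℝ) (κ : ℝ) (ρ : Measure (Euc d × Euc d')) : ℝ≥0∞ :=
  (∫⁻ p, ENNReal.ofReal (V p) ∂ρ) + ENNReal.ofReal κ * entropyH (Lref X ν) ρ


/-- A functional with closed sublevel sets on a complete space whose almost-minimizers are close
to each other attains its infimum. -/
lemma exists_minimizer_of_almost_minimizers_close {E : Type*} [PseudoEMetricSpace E]
    [CompleteSpace E] {K : Set E} {J : E → ℝ≥0∞} (hne : ∃ f ∈ K, J f ≠ ⊤)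
    (hcl : ∀ c, IsClosed {f | f ∈ K ∧ J f ≤ c})
    (hJ : ∀ ε : ℝ≥0∞, 0 < ε → ∃ η : ℝ≥0∞, 0 < η ∧ ∀ f ∈ K, ∀ g ∈ K,
      J f ≤ (⨅ h ∈ K, J h) + η → J g ≤ (⨅ h ∈ K, J h) + η → edist f g < ε) :
    ∃ f ∈ K, ∀ g ∈ K, J f ≤ J g := by
  set I := ⨅ h ∈ K, J h with hI
  have hItop : I ≠ ⊤ := by
    obtain ⟨f, hf, hfJ⟩ := hne
    exact ne_top_of_le_ne_top hfJ (iInf₂_le f hf)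
  have hex : ∀ n : ℕ, ∃ f ∈ K, J f ≤ I + (n + 1 : ℝ≥0∞)⁻¹ := by
    intro n
    have hlt : I < I + (n + 1 : ℝ≥0∞)⁻¹ :=
      ENNReal.lt_add_right hItop (ENNReal.inv_ne_zero.2 (by finiteness))
    obtain ⟨f, hf⟩ := iInf_lt_iff.1 (hI ▸ hlt)
    obtain ⟨hfK, hf⟩ := iInf_lt_iff.1 hf
    exact ⟨f, hfK, hf.le⟩
  choose u huK hu using hex
  have htend : Tendsto (fun n : ℕ => (n + 1 : ℝ≥0∞)⁻¹) atTop (𝓝 0) := by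
    have := (tendsto_add_atTop_iff_nat 1).2 ENNReal.tendsto_inv_nat_nhds_zero
    simpa using this
  have hsmall : ∀ η : ℝ≥0∞, 0 < η → ∃ N, ∀ n ≥ N, J (u n) ≤ I + η := by
    intro η hη
    obtain ⟨N, hN⟩ := eventually_atTop.1 (htend.eventually (gt_mem_nhds hη))
    exact ⟨N, fun n hn => (hu n).trans (by gcongr; exact (hN n hn).le)⟩
  have hcau : CauchySeq u := by
    rw [EMetric.cauchySeq_iff]
    intro ε hε
    obtain ⟨η, hη, h⟩ := hJ ε hε
    obtain ⟨N, hN⟩ := hsmall η hη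
    exact ⟨N, fun m hm n hn => h _ (huK m) _ (huK n) (hN m hm) (hN n hn)⟩
  obtain ⟨f, hf⟩ := cauchySeq_tendsto_of_complete hcau
  have hmem : ∀ η : ℝ≥0∞, 0 < η → f ∈ K ∧ J f ≤ I + η := by
    intro η hη
    obtain ⟨N, hN⟩ := hsmall η hη
    exact (hcl (I + η)).mem_of_tendsto hf
      (eventually_atTop.2 ⟨N, fun n hn => ⟨huK n, hN n hn⟩⟩)
  refine ⟨f, (hmem 1 one_pos).1, fun g hg => ?_⟩
  refine le_trans ?_ (iInf₂_le g hg : I ≤ J g)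
  exact ENNReal.le_of_forall_pos_le_add fun ε hε _ => (hmem ε (by simpa using hε)).2

lemma entT_eq_klFun (s : ℝ) : entT s = InformationTheory.klFun s := by
  unfold entT InformationTheory.klFun; ring

lemma entT_nonneg {s : ℝ} (hs : 0 ≤ s) : 0 ≤ entT s :=
  entT_eq_klFun s ▸ InformationTheory.klFun_nonneg hs

lemma continuous_entT : Continuous entT := by
  have : entT = InformationTheory.klFun := funext entT_eq_klFun
  exact this ▸ InformationTheory.continuous_klFun

lemma entT_le_sq {s : ℝ} (hs : 0 ≤ s) : entT s ≤ (s - 1) ^ 2 := by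
  rcases hs.eq_or_lt with rfl | hs
  · simp [entT]
  · have := mul_le_mul_of_nonneg_left (Real.log_le_sub_one_of_pos hs) hs.le
    unfold entT; nlinarith

/-- The Bregman divergence of `s log s` dominates the squared Hellinger distance. -/
lemma sq_sqrt_sub_sqrt_le {a b : ℝ} (ha : 0 ≤ a) (hb : 0 < b) :
    (√a - √b) ^ 2 ≤ a * Real.log a - a * Real.log b - a + b := by
  have hb' := Real.sqrt_pos.2 hb
  have hbs := Real.sq_sqrt hb.le
  rcases ha.eq_or_lt with rfl | ha
  · simp [hbs]
  · have ha' := Real.sqrt_pos.2 ha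
    have has := Real.sq_sqrt ha.le
    have h := Real.log_le_sub_one_of_pos (div_pos hb' ha')
    rw [Real.log_div hb'.ne' ha'.ne', Real.log_sqrt hb.le, Real.log_sqrt ha.le] at h
    have h2 := mul_le_mul_of_nonneg_left h ha.le
    have h3 : a * (√b / √a - 1) = √a * √b - a := by
      rw [mul_sub, mul_one, mul_div_assoc', sub_left_inj, div_eq_iff ha'.ne']
      linear_combination (-√b) * has
    nlinarith

/-- Quantitative convexity of the entropy integrand. -/
lemma abs_sub_add_two_entT_midpoint_le {a b : ℝ} (δ : ℝ) (ha : 0 ≤ a) (hb : 0 ≤ b) :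
    δ * |a - b| + 2 * entT ((a + b) / 2) ≤ entT a + entT b + 3 * δ ^ 2 * (a + b) := by
  rcases (add_nonneg ha hb).eq_or_lt with h0 | hpos
  · obtain rfl : a = 0 := by linarith
    obtain rfl : b = 0 := by linarith
    simp [entT]; norm_num
  · set M := (a + b) / 2 with hM
    have hMpos : 0 < M := by positivity
    have h1 := sq_sqrt_sub_sqrt_le ha hMpos
    have h2 := sq_sqrt_sub_sqrt_le hb hMpos
    have hgap : (√a - √M) ^ 2 ≤ entT a + entT b - 2 * entT M := by
      have : entT a + entT b - 2 * entT M = (a * Real.log a - a * Real.log M - a + M)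
          + (b * Real.log b - b * Real.log M - b + M) := by
        unfold entT
        linear_combination (-Real.log M) * (2 * hM)
      nlinarith [sq_nonneg (√b - √M)]
    have hu := Real.sq_sqrt ha
    have hw := Real.sq_sqrt hMpos.le
    set u := √a
    set w := √M
    have hw0 : 0 ≤ w := Real.sqrt_nonneg _
    have hab : a - b = 2 * ((u - w) * (u + w)) := by
      have : (u - w) * (u + w) = a - M := by rw [← hu, ← hw]; ring
      rw [this, hM]; ring
    have hle : δ * |a - b| ≤ (u - w) ^ 2 + δ ^ 2 * (u + w) ^ 2 := by
      rw [hab, abs_mul, abs_mul, abs_two]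
      nlinarith [sq_nonneg (|u - w| - δ * |u + w|), sq_abs (u - w), sq_abs (u + w)]
    have hsum : (u + w) ^ 2 ≤ 3 * (a + b) := by
      nlinarith [sq_nonneg (u - w)]
    nlinarith [mul_le_mul_of_nonneg_left hsum (sq_nonneg δ)]

/-- The entropic cost `∫ W f + κ (f log f - f + 1) dπ` of a density `f`. -/
def densityCost {α : Type*} [MeasurableSpace α] (π : Measure α) (W : α → ℝ) (κ : ℝ)
    (f : Lp ℝ 1 π) : ℝ≥0∞ :=
  ∫⁻ p, ENNReal.ofReal (W p * f p + κ * entT (f p)) ∂π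

/-- The densities with respect to `π` of couplings of `μ` and `ν`. -/
def couplingDensities {α β : Type*} [MeasurableSpace α] [MeasurableSpace β]
    (π : Measure (α × β)) (μ : Measure α) (ν : Measure β) : Set (Lp ℝ 1 π) :=
  {f | 0 ≤ f ∧ (∀ A, MeasurableSet A → ∫ p in Prod.fst ⁻¹' A, f p ∂π = μ.real A) ∧
    ∀ B, MeasurableSet B → ∫ p in Prod.snd ⁻¹' B, f p ∂π = ν.real B}

section Density

variable {α β : Type*} [MeasurableSpace α] [MeasurableSpace β]

lemma isClosed_couplingDensities (π : Measure (α × β)) (μ : Measure α) (ν : Measure β) :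
    IsClosed (couplingDensities π μ ν) := by
  have h : couplingDensities π μ ν = {f : Lp ℝ 1 π | 0 ≤ f} ∩
      ((⋂ A, ⋂ _ : MeasurableSet A,
        {f : Lp ℝ 1 π | ∫ p in Prod.fst ⁻¹' A, f p ∂π = μ.real A}) ∩
      ⋂ B, ⋂ _ : MeasurableSet B,
        {f : Lp ℝ 1 π | ∫ p in Prod.snd ⁻¹' B, f p ∂π = ν.real B}) := by
    ext f; simp [couplingDensities]
  rw [h]
  refine isClosed_Ici.inter (IsClosed.inter ?_ ?_)
  · exact isClosed_iInter fun A => isClosed_iInter fun _ =>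
      isClosed_eq (continuous_setIntegral _) continuous_const
  · exact isClosed_iInter fun A => isClosed_iInter fun _ =>
      isClosed_eq (continuous_setIntegral _) continuous_const

lemma midpoint_mem_couplingDensities {π : Measure (α × β)} {μ : Measure α} {ν : Measure β}
    {f g : Lp ℝ 1 π} (hf : f ∈ couplingDensities π μ ν) (hg : g ∈ couplingDensities π μ ν) :
    (2⁻¹ : ℝ) • (f + g) ∈ couplingDensities π μ ν := by
  have hint : ∀ S : Set (α × β), ∫ p in S, ((2⁻¹ : ℝ) • (f + g) : Lp ℝ 1 π) p ∂π
      = 2⁻¹ * (∫ p in S, f p ∂π + ∫ p in S, g p ∂π) := by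
    intro S
    have hfi := L1.integrable_coeFn f
    have hgi := L1.integrable_coeFn g
    rw [← integral_add hfi.integrableOn hgi.integrableOn, ← integral_const_mul]
    refine integral_congr_ae (ae_restrict_of_ae ?_)
    filter_upwards [Lp.coeFn_smul (2⁻¹ : ℝ) (f + g), Lp.coeFn_add f g] with p h1 h2
    rw [h1, Pi.smul_apply, h2]; rfl
  refine ⟨?_, fun A hA => ?_, fun B hB => ?_⟩
  · have h0 : 0 ≤ f + g := add_nonneg hf.1 hg.1
    rw [← Lp.coeFn_nonneg] at h0 ⊢
    filter_upwards [h0, Lp.coeFn_smul (2⁻¹ : ℝ) (f + g)] with p h1 h2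
    rw [h2, Pi.smul_apply]
    exact smul_nonneg (by norm_num) h1
  · rw [hint, hf.2.1 A hA, hg.2.1 A hA]; ring
  · rw [hint, hf.2.2 B hB, hg.2.2 B hB]; ring

lemma lintegral_ofReal_of_mem_couplingDensities {π : Measure (α × β)} {μ : Measure α}
    {ν : Measure β} [IsProbabilityMeasure μ] {f : Lp ℝ 1 π}
    (hf : f ∈ couplingDensities π μ ν) : ∫⁻ p, ENNReal.ofReal (f p) ∂π = 1 := by
  rw [← ofReal_integral_eq_lintegral_ofReal (L1.integrable_coeFn f) ((Lp.coeFn_nonneg f).2 hf.1)]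
  have := hf.2.1 univ MeasurableSet.univ
  simp only [preimage_univ, Measure.restrict_univ, probReal_univ] at this
  simp [this]

lemma aemeasurable_densityCost_integrand (π : Measure α) {W : α → ℝ} (hW : Measurable W) (κ : ℝ)
    (f : Lp ℝ 1 π) :
    AEMeasurable (fun p => ENNReal.ofReal (W p * f p + κ * entT (f p))) π := by
  have hf : AEMeasurable f π := (Lp.aestronglyMeasurable f).aemeasurable
  exact ((hW.aemeasurable.mul hf).add
    ((continuous_entT.measurable.comp_aemeasurable hf).const_mul κ)).ennreal_ofReal

lemma densityCost_le_of_tendsto {π : Measure α} {W : α → ℝ} (hW : Measurable W) {κ : ℝ}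
    {u : ℕ → Lp ℝ 1 π} {f : Lp ℝ 1 π} (hu : Tendsto u atTop (𝓝 f)) {c : ℝ≥0∞}
    (hc : ∀ n, densityCost π W κ (u n) ≤ c) : densityCost π W κ f ≤ c := by
  obtain ⟨φ, -, hφ⟩ := (tendstoInMeasure_of_tendsto_Lp hu).exists_seq_tendsto_ae
  calc densityCost π W κ f
      = ∫⁻ p, liminf (fun n => ENNReal.ofReal (W p * u (φ n) p + κ * entT (u (φ n) p))) atTop
          ∂π := by
        refine lintegral_congr_ae ?_
        filter_upwards [hφ] with p hp
        refine (Tendsto.liminf_eq ?_).symm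
        exact ENNReal.tendsto_ofReal ((hp.const_mul _).add
          (((continuous_entT.tendsto _).comp hp).const_mul κ))
    _ ≤ liminf (fun n => densityCost π W κ (u (φ n))) atTop :=
        lintegral_liminf_le' fun n => aemeasurable_densityCost_integrand π hW κ _
    _ ≤ c := liminf_le_of_frequently_le' (Frequently.of_forall fun n => hc _)

lemma isClosed_sublevel_densityCost (π : Measure (α × β)) (μ : Measure α) (ν : Measure β)
    {W : α × β → ℝ} (hW : Measurable W) (κ : ℝ) (c : ℝ≥0∞) :
    IsClosed {f | f ∈ couplingDensities π μ ν ∧ densityCost π W κ f ≤ c} := by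
  refine IsSeqClosed.isClosed fun u f hu huf => ⟨?_, ?_⟩
  · exact (isClosed_couplingDensities π μ ν).mem_of_tendsto huf (.of_forall fun n => (hu n).1)
  · exact densityCost_le_of_tendsto hW huf fun n => (hu n).2

lemma edist_add_two_densityCost_midpoint_le {π : Measure α} {W : α → ℝ} (hW : Measurable W)
    (hW0 : ∀ p, 0 ≤ W p) {κ : ℝ} (hκ : 0 < κ) {f g : Lp ℝ 1 π} (hf : 0 ≤ f) (hg : 0 ≤ g)
    {δ : ℝ} (hδ : 0 < δ) :
    ENNReal.ofReal (κ * δ) * edist f g + 2 * densityCost π W κ ((2⁻¹ : ℝ) • (f + g)) ≤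
      densityCost π W κ f + densityCost π W κ g + ENNReal.ofReal (3 * κ * δ ^ 2) *
        (∫⁻ p, ENNReal.ofReal (f p) ∂π + ∫⁻ p, ENNReal.ofReal (g p) ∂π) := by
  have hfm : AEMeasurable f π := (Lp.aestronglyMeasurable f).aemeasurable
  have hgm : AEMeasurable g π := (Lp.aestronglyMeasurable g).aemeasurable
  have hfg : AEMeasurable (fun p => ENNReal.ofReal (f p) + ENNReal.ofReal (g p)) π :=
    hfm.ennreal_ofReal.add hgm.ennreal_ofReal
  have hcost : AEMeasurable (fun p => ENNReal.ofReal (W p * f p + κ * entT (f p)) +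
      ENNReal.ofReal (W p * g p + κ * entT (g p))) π :=
    (aemeasurable_densityCost_integrand π hW κ f).add
      (aemeasurable_densityCost_integrand π hW κ g)
  rw [L1.edist_def]
  unfold densityCost
  rw [← lintegral_const_mul'' _ (hfm.edist hgm),
    ← lintegral_const_mul'' _ (aemeasurable_densityCost_integrand π hW κ _),
    ← lintegral_add_left' ((hfm.edist hgm).const_mul _),
    ← lintegral_add_left' (aemeasurable_densityCost_integrand π hW κ _),
    ← lintegral_add_left' hfm.ennreal_ofReal,
    ← lintegral_const_mul'' _ hfg,
    ← lintegral_add_left' hcost]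
  refine lintegral_mono_ae ?_
  filter_upwards [(Lp.coeFn_nonneg f).2 hf, (Lp.coeFn_nonneg g).2 hg,
    Lp.coeFn_smul (2⁻¹ : ℝ) (f + g), Lp.coeFn_add f g] with p hfp hgp h1 h2
  have hmid : ((2⁻¹ : ℝ) • (f + g) : Lp ℝ 1 π) p = (f p + g p) / 2 := by
    rw [h1, Pi.smul_apply, h2, Pi.add_apply, smul_eq_mul]; ring
  rw [hmid]
  simp only [Pi.zero_apply] at hfp hgp
  generalize f p = a at *
  generalize g p = b at *
  have ha := entT_nonneg hfp
  have hb := entT_nonneg hgp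
  have hm := entT_nonneg (s := (a + b) / 2) (by positivity)
  have hw := hW0 p
  rw [edist_dist, Real.dist_eq, ← ENNReal.ofReal_mul (by positivity),
    ← ENNReal.ofReal_ofNat 2, ← ENNReal.ofReal_mul (by positivity),
    ← ENNReal.ofReal_add (by positivity) (by positivity),
    ← ENNReal.ofReal_add (by positivity) (by positivity),
    ← ENNReal.ofReal_add (by positivity) (by positivity),
    ← ENNReal.ofReal_mul (by positivity),
    ← ENNReal.ofReal_add (by positivity) (by positivity)]
  refine ENNReal.ofReal_le_ofReal ?_
  nlinarith [mul_le_mul_of_nonneg_left (abs_sub_add_two_entT_midpoint_le δ hfp hgp) hκ.le]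

/-- Almost-minimizers of the density cost are close in `L¹`. -/
lemma edist_le_of_almost_minimizers {π : Measure (α × β)} {μ : Measure α} {ν : Measure β}
    [IsProbabilityMeasure μ] {W : α × β → ℝ} (hW : Measurable W) (hW0 : ∀ p, 0 ≤ W p)
    {κ : ℝ} (hκ : 0 < κ) {I : ℝ≥0∞} (hI : I ≠ ⊤)
    (hIle : ∀ h ∈ couplingDensities π μ ν, I ≤ densityCost π W κ h) {δ : ℝ} (hδ : 0 < δ)
    {f g : Lp ℝ 1 π} (hf : f ∈ couplingDensities π μ ν) (hg : g ∈ couplingDensities π μ ν)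
    (hfI : densityCost π W κ f ≤ I + ENNReal.ofReal (κ * δ ^ 2))
    (hgI : densityCost π W κ g ≤ I + ENNReal.ofReal (κ * δ ^ 2)) :
    edist f g ≤ ENNReal.ofReal (8 * δ) := by
  have h := edist_add_two_densityCost_midpoint_le hW hW0 hκ hf.1 hg.1 hδ
  rw [lintegral_ofReal_of_mem_couplingDensities hf,
    lintegral_ofReal_of_mem_couplingDensities hg] at h
  have hmid := hIle _ (midpoint_mem_couplingDensities hf hg)
  have h2 : ENNReal.ofReal (κ * δ) * edist f g + 2 * I ≤
      ENNReal.ofReal (κ * δ) * ENNReal.ofReal (8 * δ) + 2 * I := by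
    calc ENNReal.ofReal (κ * δ) * edist f g + 2 * I
        ≤ _ := by gcongr
      _ ≤ _ := h
      _ ≤ (I + ENNReal.ofReal (κ * δ ^ 2)) + (I + ENNReal.ofReal (κ * δ ^ 2))
          + ENNReal.ofReal (3 * κ * δ ^ 2) * (1 + 1) := by gcongr
      _ = (ENNReal.ofReal (κ * δ ^ 2) + ENNReal.ofReal (κ * δ ^ 2)
          + ENNReal.ofReal (3 * κ * δ ^ 2) * ENNReal.ofReal 2) + 2 * I := by
        rw [ENNReal.ofReal_ofNat]; ring
      _ = _ := by
        rw [← ENNReal.ofReal_mul (by positivity), ← ENNReal.ofReal_mul (by positivity),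
          ← ENNReal.ofReal_add (by positivity) (by positivity),
          ← ENNReal.ofReal_add (by positivity) (by positivity)]
        congr 2; ring
  have h3 := (ENNReal.add_le_add_iff_right (by finiteness)).1 h2
  exact (ENNReal.mul_le_mul_iff_right (by simpa using mul_pos hκ hδ) ENNReal.ofReal_ne_top).1 h3

lemma exists_minimizer_densityCost {π : Measure (α × β)} {μ : Measure α} {ν : Measure β}
    [IsProbabilityMeasure μ] {W : α × β → ℝ} (hW : Measurable W) (hW0 : ∀ p, 0 ≤ W p)
    {κ : ℝ} (hκ : 0 < κ) (hne : ∃ f ∈ couplingDensities π μ ν, densityCost π W κ f ≠ ⊤) :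
    ∃ f ∈ couplingDensities π μ ν, ∀ g ∈ couplingDensities π μ ν,
      densityCost π W κ f ≤ densityCost π W κ g := by
  refine exists_minimizer_of_almost_minimizers_close hne
    (isClosed_sublevel_densityCost π μ ν hW κ) fun ε hε => ?_
  obtain ⟨r, -, hr0, hrε⟩ := ENNReal.lt_iff_exists_real_btwn.1 hε
  have hr : 0 < r := by simpa using hr0
  refine ⟨ENNReal.ofReal (κ * (r / 8) ^ 2), by simp; positivity, fun f hf g hg hfI hgI => ?_⟩
  have hI : (⨅ h ∈ couplingDensities π μ ν, densityCost π W κ h) ≠ ⊤ := by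
    obtain ⟨f, hf, hfJ⟩ := hne
    exact ne_top_of_le_ne_top hfJ (iInf₂_le f hf)
  refine (edist_le_of_almost_minimizers hW hW0 hκ hI (fun h hh => iInf₂_le h hh)
    (by positivity) hf hg hfI hgI).trans_lt ?_
  rwa [mul_div_cancel₀ r (by norm_num)]

lemma eq_of_minimizers_densityCost {π : Measure (α × β)} {μ : Measure α} {ν : Measure β}
    [IsProbabilityMeasure μ] {W : α × β → ℝ} (hW : Measurable W) (hW0 : ∀ p, 0 ≤ W p)
    {κ : ℝ} (hκ : 0 < κ) {f g : Lp ℝ 1 π} (hf : f ∈ couplingDensities π μ ν)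
    (hg : g ∈ couplingDensities π μ ν) (htop : densityCost π W κ f ≠ ⊤)
    (hfmin : ∀ h ∈ couplingDensities π μ ν, densityCost π W κ f ≤ densityCost π W κ h)
    (hgf : densityCost π W κ g ≤ densityCost π W κ f) : f = g := by
  refine edist_le_zero.1 (ENNReal.le_of_forall_pos_le_add fun ε hε _ => ?_)
  have hε' : (0 : ℝ) < ε := hε
  have := edist_le_of_almost_minimizers hW hW0 hκ htop hfmin (δ := ε / 8) (by positivity) hf hg
    le_self_add (hgf.trans le_self_add)
  rwa [mul_div_cancel₀ _ (by norm_num), ENNReal.ofReal_coe_nnreal, ← zero_add (ε : ℝ≥0∞)] at this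

end Density

/-- The entropic transport cost `∫ W dρ + κ H(ρ|π)`. -/
def entropicCost {α : Type*} [MeasurableSpace α] (π : Measure α) (W : α → ℝ) (κ : ℝ)
    (ρ : Measure α) : ℝ≥0∞ :=
  (∫⁻ p, ENNReal.ofReal (W p) ∂ρ) + ENNReal.ofReal κ * entropyH π ρ

section Cost

variable {α β : Type*} [MeasurableSpace α] [MeasurableSpace β]

lemma entropicCost_withDensity {π : Measure α} [SigmaFinite π] {W : α → ℝ} (hW : Measurable W)
    (hW0 : ∀ p, 0 ≤ W p) {κ : ℝ} (hκ : 0 < κ) {f : α → ℝ} (hfm : AEMeasurable f π)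
    (hf : 0 ≤ᵐ[π] f) :
    entropicCost π W κ (π.withDensity fun p => ENNReal.ofReal (f p)) =
      ∫⁻ p, ENNReal.ofReal (W p * f p + κ * entT (f p)) ∂π := by
  have hent : AEMeasurable (fun p => ENNReal.ofReal (entT (f p))) π :=
    (continuous_entT.measurable.comp_aemeasurable hfm).ennreal_ofReal
  rw [entropicCost, entropyH, if_pos (withDensity_absolutelyContinuous _ _),
    lintegral_withDensity_eq_lintegral_mul₀ hfm.ennreal_ofReal
      hW.ennreal_ofReal.aemeasurable]
  have hrn : ∫⁻ p, ENNReal.ofReal (entT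
      (((π.withDensity fun p => ENNReal.ofReal (f p)).rnDeriv π p).toReal)) ∂π =
      ∫⁻ p, ENNReal.ofReal (entT (f p)) ∂π := by
    refine lintegral_congr_ae ?_
    filter_upwards [Measure.rnDeriv_withDensity₀ π hfm.ennreal_ofReal, hf] with p h1 h2
    rw [h1, ENNReal.toReal_ofReal h2]
  rw [hrn, ← lintegral_const_mul'' _ hent, ← lintegral_add_right' _ (hent.const_mul _)]
  refine lintegral_congr_ae ?_
  filter_upwards [hf] with p hp
  rw [Pi.mul_apply, ← ENNReal.ofReal_mul hp, ← ENNReal.ofReal_mul hκ.le,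
    ← ENNReal.ofReal_add (mul_nonneg hp (hW0 p)) (mul_nonneg hκ.le (entT_nonneg hp)),
    mul_comm (f p)]

lemma entropicCost_withDensity_Lp {π : Measure α} [SigmaFinite π] {W : α → ℝ}
    (hW : Measurable W) (hW0 : ∀ p, 0 ≤ W p) {κ : ℝ} (hκ : 0 < κ) {f : Lp ℝ 1 π} (hf : 0 ≤ f) :
    entropicCost π W κ (π.withDensity fun p => ENNReal.ofReal (f p)) = densityCost π W κ f :=
  entropicCost_withDensity hW hW0 hκ (Lp.aestronglyMeasurable f).aemeasurable
    ((Lp.coeFn_nonneg f).2 hf)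

lemma withDensity_mem_couplings {π : Measure (α × β)} {μ : Measure α} {ν : Measure β}
    [IsProbabilityMeasure μ] [IsProbabilityMeasure ν] {f : Lp ℝ 1 π}
    (hf : f ∈ couplingDensities π μ ν) :
    (π.withDensity fun p => ENNReal.ofReal (f p)) ∈ Couplings μ ν := by
  have happ : ∀ S, MeasurableSet S → (π.withDensity fun p => ENNReal.ofReal (f p)) S =
      ENNReal.ofReal (∫ p in S, f p ∂π) := fun S hS => by
    rw [withDensity_apply _ hS, ofReal_integral_eq_lintegral_ofReal
      (L1.integrable_coeFn f).integrableOn (ae_restrict_of_ae ((Lp.coeFn_nonneg f).2 hf.1))]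
  refine ⟨⟨?_⟩, ?_, ?_⟩
  · rw [withDensity_apply _ MeasurableSet.univ, Measure.restrict_univ,
      lintegral_ofReal_of_mem_couplingDensities hf]
  · ext A hA
    rw [Measure.map_apply measurable_fst hA, happ _ (measurable_fst hA), hf.2.1 A hA,
      ofReal_measureReal]
  · ext B hB
    rw [Measure.map_apply measurable_snd hB, happ _ (measurable_snd hB), hf.2.2 B hB,
      ofReal_measureReal]

lemma exists_mem_couplingDensities {π : Measure (α × β)} [SigmaFinite π] {μ : Measure α}
    {ν : Measure β} {σ : Measure (α × β)} (hσ : σ ∈ Couplings μ ν) (hac : σ ≪ π) :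
    ∃ f ∈ couplingDensities π μ ν, (π.withDensity fun p => ENNReal.ofReal (f p)) = σ := by
  have := hσ.1
  have hint : Integrable (fun p => (σ.rnDeriv π p).toReal) π := Measure.integrable_toReal_rnDeriv
  have hcoe := hint.coeFn_toL1
  have hset : ∀ S, ∫ p in S, hint.toL1 _ p ∂π = σ.real S := fun S => by
    rw [integral_congr_ae (ae_restrict_of_ae hcoe), Measure.setIntegral_toReal_rnDeriv hac]
  refine ⟨hint.toL1 _, ⟨?_, fun A hA => ?_, fun B hB => ?_⟩, ?_⟩
  · rw [← Lp.coeFn_nonneg]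
    filter_upwards [hcoe] with p hp
    rw [hp]
    exact ENNReal.toReal_nonneg
  · rw [hset, ← hσ.2.1, map_measureReal_apply measurable_fst hA]
  · rw [hset, ← hσ.2.2, map_measureReal_apply measurable_snd hB]
  · conv_rhs => rw [← Measure.withDensity_rnDeriv_eq σ π hac]
    refine withDensity_congr_ae ?_
    filter_upwards [hcoe, Measure.rnDeriv_lt_top σ π] with p hp hlt
    rw [hp, ENNReal.ofReal_toReal hlt.ne]

lemma absolutelyContinuous_of_entropicCost_ne_top {π ρ : Measure α} {W : α → ℝ} {κ : ℝ}
    (hκ : 0 < κ) (h : entropicCost π W κ ρ ≠ ⊤) : ρ ≪ π := by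
  by_contra hac
  refine h ?_
  rw [entropicCost, entropyH, if_neg hac, ENNReal.mul_top (by simpa using hκ), add_top]

/-- Existence and uniqueness of entropic optimal transport plans for a measurable cost and a
σ-finite reference measure. -/
theorem existsUnique_minimizer_entropicCost {π : Measure (α × β)} [SigmaFinite π] {μ : Measure α}
    {ν : Measure β} [IsProbabilityMeasure μ] [IsProbabilityMeasure ν] {W : α × β → ℝ}
    (hW : Measurable W) (hW0 : ∀ p, 0 ≤ W p) {κ : ℝ} (hκ : 0 < κ)
    (hne : ∃ σ ∈ Couplings μ ν, entropicCost π W κ σ ≠ ⊤) :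
    ∃! ρ, ρ ∈ Couplings μ ν ∧
      ∀ σ ∈ Couplings μ ν, entropicCost π W κ ρ ≤ entropicCost π W κ σ := by
  have hdens : ∀ σ ∈ Couplings μ ν, entropicCost π W κ σ ≠ ⊤ →
      ∃ f ∈ couplingDensities π μ ν, (π.withDensity fun p => ENNReal.ofReal (f p)) = σ ∧
        densityCost π W κ f = entropicCost π W κ σ := by
    intro σ hσ hfin
    obtain ⟨f, hf, rfl⟩ := exists_mem_couplingDensities hσ
      (absolutelyContinuous_of_entropicCost_ne_top hκ hfin)
    exact ⟨f, hf, rfl, (entropicCost_withDensity_Lp hW hW0 hκ hf.1).symm⟩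
  obtain ⟨σ₀, hσ₀, hfin⟩ := hne
  obtain ⟨f₀, hf₀, -, hcost₀⟩ := hdens σ₀ hσ₀ hfin
  obtain ⟨f, hf, hmin⟩ := exists_minimizer_densityCost hW hW0 hκ ⟨f₀, hf₀, hcost₀ ▸ hfin⟩
  have hftop : densityCost π W κ f ≠ ⊤ := ne_top_of_le_ne_top (hcost₀ ▸ hfin) (hmin f₀ hf₀)
  have hcost := entropicCost_withDensity_Lp hW hW0 hκ hf.1
  refine ⟨π.withDensity fun p => ENNReal.ofReal (f p),
    ⟨withDensity_mem_couplings hf, fun σ hσ => ?_⟩, fun ρ hρ => ?_⟩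
  · by_cases hσfin : entropicCost π W κ σ = ⊤
    · rw [hσfin]; exact le_top
    · obtain ⟨g, hg, -, hgcost⟩ := hdens σ hσ hσfin
      rw [hcost, ← hgcost]
      exact hmin g hg
  · have hle := hρ.2 _ (withDensity_mem_couplings hf)
    rw [hcost] at hle
    obtain ⟨g, hg, rfl, hgcost⟩ := hdens ρ hρ.1 (ne_top_of_le_ne_top hftop hle)
    rw [eq_of_minimizers_densityCost hW hW0 hκ hf hg hftop hmin (hgcost ▸ hle)]

end Cost

/-- The product coupling has finite entropic cost when the first marginal has bounded density with
respect to a finite measure and the transport cost is bounded. -/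
lemma entropicCost_prod_ne_top {α β : Type*} [MeasurableSpace α] [MeasurableSpace β]
    {l : Measure α} [IsFiniteMeasure l] {ν : Measure β} [IsProbabilityMeasure ν]
    {W : α × β → ℝ} (hW : Measurable W) (hW0 : ∀ p, 0 ≤ W p) {B : ℝ} (hWB : ∀ p, W p ≤ B)
    {κ : ℝ} (hκ : 0 < κ) {m : α → ℝ} (hm : Measurable m) {C : ℝ}
    (hm0 : ∀ᵐ x ∂l, 0 ≤ m x) (hmC : ∀ᵐ x ∂l, m x ≤ C) :
    entropicCost (l.prod ν) W κ ((l.withDensity fun x => ENNReal.ofReal (m x)).prod ν) ≠ ⊤ := by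
  have hm0' : ∀ᵐ p ∂(l.prod ν), 0 ≤ m p.1 := Measure.quasiMeasurePreserving_fst.ae hm0
  have hmC' : ∀ᵐ p ∂(l.prod ν), m p.1 ≤ C := Measure.quasiMeasurePreserving_fst.ae hmC
  rw [prod_withDensity_left hm.ennreal_ofReal,
    entropicCost_withDensity hW hW0 hκ (f := fun p => m p.1)
      (hm.comp measurable_fst).aemeasurable hm0']
  have hbound : ∫⁻ p, ENNReal.ofReal (W p * m p.1 + κ * entT (m p.1)) ∂(l.prod ν) ≤
      ∫⁻ _, ENNReal.ofReal (B * C + κ * (C ^ 2 + 1)) ∂(l.prod ν) := by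
    refine lintegral_mono_ae ?_
    filter_upwards [hm0', hmC'] with p h0 hC
    refine ENNReal.ofReal_le_ofReal (add_le_add ?_ ?_)
    · exact mul_le_mul (hWB p) hC h0 ((hW0 p).trans (hWB p))
    · refine mul_le_mul_of_nonneg_left ((entT_le_sq h0).trans ?_) hκ.le
      nlinarith
  refine ne_top_of_le_ne_top ?_ hbound
  rw [lintegral_const]
  finiteness

lemma prod_mem_couplings {α β : Type*} [MeasurableSpace α] [MeasurableSpace β]
    (μ : Measure α) (ν : Measure β) [IsProbabilityMeasure μ] [IsProbabilityMeasure ν] :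
    μ.prod ν ∈ Couplings μ ν :=
  ⟨inferInstance, by simp, by simp⟩

lemma ae_mem_prod_of_mem_couplings {α β : Type*} [MeasurableSpace α] [MeasurableSpace β]
    {μ : Measure α} {ν : Measure β} {σ : Measure (α × β)} (hσ : σ ∈ Couplings μ ν)
    {X : Set α} {Y : Set β} (hX : ∀ᵐ x ∂μ, x ∈ X) (hY : ∀ᵐ y ∂ν, y ∈ Y) :
    ∀ᵐ p ∂σ, p ∈ X ×ˢ Y := by
  rw [← hσ.2.1] at hX
  rw [← hσ.2.2] at hY
  filter_upwards [ae_of_ae_map measurable_fst.aemeasurable hX,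
    ae_of_ae_map measurable_snd.aemeasurable hY] with p h1 h2
  exact ⟨h1, h2⟩

/-- for `V ∈ C(X×Y)` nonnegative, `κ > 0`, `ν` a probability measure on `Y`, and
`μ` a probability measure on `X` with Lebesgue density bounded above and away from zero, the
energy `E(ρ) = ∫ V dρ + κ H(ρ|ν)` admits a unique minimizer over `Γ(μ,ν)`. -/
theorem stmt5 {d d' : ℕ} (X : Set (Euc d)) (Y : Set (Euc d'))
    (hX : IsCompact X) (hXne : X.Nonempty) (hY : IsCompact Y) (hYne : Y.Nonempty)
    (V : Euc d × Euc d' → ℝ) (hV : ContinuousOn V (X ×ˢ Y)) (hV0 : ∀ p, 0 ≤ V p)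
    (κ : ℝ) (hκ : 0 < κ)
    (ν : Measure (Euc d')) [IsProbabilityMeasure ν] (hνY : ν Yᶜ = 0)
    (m : Euc d → ℝ) (hmMeas : Measurable m)
    (c C : ℝ) (hc : 0 < c) (hmbound : ∀ x ∈ X, c ≤ m x ∧ m x ≤ C)
    (μ : Measure (Euc d)) [IsProbabilityMeasure μ]
    (hμ : μ = (volume.restrict X).withDensity (fun x => ENNReal.ofReal (m x))) :
    ∃! ρStar : Measure (Euc d × Euc d'),
      ρStar ∈ Couplings μ ν ∧
        ∀ σ ∈ Couplings μ ν, energyE X ν V κ ρStar ≤ energyE X ν V κ σ := by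
  have hXYm : MeasurableSet (X ×ˢ Y) := hX.measurableSet.prod hY.measurableSet
  set W : Euc d × Euc d' → ℝ := (X ×ˢ Y).indicator V with hWdef
  have hW : Measurable W := by
    classical
    rw [hWdef, ← Set.piecewise_eq_indicator]
    exact hV.measurable_piecewise continuousOn_const hXYm
  have hW0 : ∀ p, 0 ≤ W p := indicator_nonneg fun p _ => hV0 p
  obtain ⟨B, hB⟩ := (hX.prod hY).bddAbove_image hV
  have hWB : ∀ p, W p ≤ max B 0 := fun p => indicator_le'
    (fun q hq => (hB (mem_image_of_mem V hq)).trans (le_max_left _ _))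
    (fun _ _ => le_max_right _ _) p
  have : IsFiniteMeasure (volume.restrict X) := isFiniteMeasure_restrict.2 hX.measure_lt_top.ne
  have haeX : ∀ᵐ x ∂(volume.restrict X), x ∈ X := ae_restrict_mem hX.measurableSet
  have hcost : ∀ σ ∈ Couplings μ ν,
      energyE X ν V κ σ = entropicCost ((volume.restrict X).prod ν) W κ σ := by
    intro σ hσ
    have hXY : ∀ᵐ p ∂σ, p ∈ X ×ˢ Y := ae_mem_prod_of_mem_couplings hσ
      (hμ ▸ (withDensity_absolutelyContinuous _ _).ae_le haeX) hνY
    unfold energyE entropicCost Lref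
    congr 1
    refine lintegral_congr_ae ?_
    filter_upwards [hXY] with p hp
    rw [hWdef, indicator_of_mem hp]
  have hfin : entropicCost ((volume.restrict X).prod ν) W κ (μ.prod ν) ≠ ⊤ := by
    rw [hμ]
    refine entropicCost_prod_ne_top (C := C) hW hW0 hWB hκ hmMeas ?_ ?_
    · filter_upwards [haeX] with x hx using hc.le.trans (hmbound x hx).1
    · filter_upwards [haeX] with x hx using (hmbound x hx).2
  refine (existsUnique_congr fun ρ => and_congr_right fun hρ => forall₂_congr fun σ hσ => ?_).2
    (existsUnique_minimizer_entropicCost hW hW0 hκ ⟨_, prod_mem_couplings μ ν, hfin⟩)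
  rw [hcost ρ hρ, hcost σ hσ]

end
end
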